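/- Let P be a simple polygon and let p, q, r be three distinct points in the interior of P such that {p, q, r} together with the vertices of P is in strong general position. Write the geodesics as vertex sequences π(p,q) = ⟨p=v₀,v₁,…,v_k=q⟩ and π(p,r) = ⟨p=u₀,u₁,…,u_{k'}=r⟩. Then there is a smallest index i > 0 with v_i ≠ u_i, and det(v_i − v_{i−1}, u_i − v_{i−1}) ≠ 0; consequently, the triple (p,q,r) is in exactly one of geodesic clockwise order or geodesic counterclockwise order. -/

import Mathlib

open scoped RealInnerProductSpace ENNReal Classical

noncomputable section

/-- Points of the Euclidean plane. -/
abbrev Pt : Type := EuclideanSpace ℝ (Fin 2)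

/-- The planar determinant `det (u, v)` of two vectors. -/
def det2 (u v : Pt) : ℝ := u 0 * v 1 - u 1 * v 0

/-- No three of the points of `S` are collinear. -/
def NoThreeCollinear (S : Set Pt) : Prop :=
  ∀ p ∈ S, ∀ q ∈ S, ∀ r ∈ S, p ≠ q → p ≠ r → q ≠ r → det2 (q - p) (r - p) ≠ 0

/-- `S` is in strong general position: no three points are collinear and for any four
distinct points `p₁ p₂ p₃ p₄` the line through `p₁,p₂` is not parallel to the line
through `p₃,p₄`. -/
def StrongGenPos (S : Set Pt) : Prop :=
  NoThreeCollinear S ∧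
    ∀ p₁ ∈ S, ∀ p₂ ∈ S, ∀ p₃ ∈ S, ∀ p₄ ∈ S,
      p₁ ≠ p₂ → p₁ ≠ p₃ → p₁ ≠ p₄ → p₂ ≠ p₃ → p₂ ≠ p₄ → p₃ ≠ p₄ →
        det2 (p₂ - p₁) (p₄ - p₃) ≠ 0

/-- A simple polygon, given by a cyclic sequence of `n ≥ 3` distinct vertices
(encoded as an `n`-periodic function `ℕ → Pt`), such that no point of the plane lies on
more than two closed edges, and the only points lying on exactly two edges are vertices. -/
structure SimplePolygon where
  n : ℕ
  three_le : 3 ≤ n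
  vtx : ℕ → Pt
  periodic : ∀ i, vtx (i + n) = vtx i
  inj : ∀ i < n, ∀ j < n, vtx i = vtx j → i = j
  simple : ∀ x : Pt, {i | i < n ∧ x ∈ segment ℝ (vtx i) (vtx (i + 1))}.ncard ≤ 2
  vtx_of_two : ∀ x : Pt,
    {i | i < n ∧ x ∈ segment ℝ (vtx i) (vtx (i + 1))}.ncard = 2 → ∃ i < n, x = vtx i

namespace SimplePolygon

/-- The boundary of a simple polygon: the union of its closed edges. -/
def boundary (P : SimplePolygon) : Set Pt :=
  ⋃ i ∈ Finset.range P.n, segment ℝ (P.vtx i) (P.vtx (i + 1))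

/-- The interior of a simple polygon: the union of the bounded connected components of the
complement of the boundary. -/
def interior (P : SimplePolygon) : Set Pt :=
  {x | x ∉ P.boundary ∧ Bornology.IsBounded (connectedComponentIn P.boundaryᶜ x)}

/-- A simple polygon, regarded as a point set: boundary together with interior. -/
def region (P : SimplePolygon) : Set Pt := P.boundary ∪ P.interior

/-- The set of vertices of the polygon. -/
def vertexSet (P : SimplePolygon) : Set Pt := {x | ∃ i < P.n, x = P.vtx i}

/-- Twice the shoelace signed area. -/
def shoelace (P : SimplePolygon) : ℝ := ∑ i ∈ Finset.range P.n, det2 (P.vtx i) (P.vtx (i + 1))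

/-- The vertices are listed in counterclockwise order (positive shoelace signed area). -/
def CCW (P : SimplePolygon) : Prop := 0 < P.shoelace

/-- The vertex `vtx (i+1)` is a convex vertex:
`det (v_{i+1} − v_i, v_{i+2} − v_{i+1}) > 0` (vertices listed counterclockwise). -/
def ConvexAt (P : SimplePolygon) (i : ℕ) : Prop :=
  0 < det2 (P.vtx (i + 1) - P.vtx i) (P.vtx (i + 2) - P.vtx (i + 1))

/-- The number of convex vertices of the polygon. -/
def numConvex (P : SimplePolygon) : ℕ := {i | i < P.n ∧ P.ConvexAt i}.ncard

/-- Continuous paths from `s` to `t` staying inside the polygon. -/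
def pathsIn (P : SimplePolygon) (s t : Pt) : Set (ℝ → Pt) :=
  {γ | ContinuousOn γ (Set.Icc 0 1) ∧ γ 0 = s ∧ γ 1 = t ∧ γ '' Set.Icc (0 : ℝ) 1 ⊆ P.region}

/-- The geodesic distance between `s` and `t` inside the polygon: the infimum of the
lengths (total variations) of continuous paths in the polygon from `s` to `t`. -/
def geodDist (P : SimplePolygon) (s t : Pt) : ℝ≥0∞ :=
  ⨅ γ ∈ P.pathsIn s t, eVariationOn γ (Set.Icc 0 1)

end SimplePolygon

/-- Length of a polygonal path through a list of points. -/
def polylineLen : List Pt → ℝ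
  | [] => 0
  | [_] => 0
  | a :: b :: l => dist a b + polylineLen (b :: l)

/-- The polygonal path through a list of points, as a point set. -/
def polylineSet : List Pt → Set Pt
  | [] => ∅
  | [a] => {a}
  | a :: b :: l => segment ℝ a b ∪ polylineSet (b :: l)

/-- `L` is the vertex sequence of the geodesic from `s` to `t` inside the polygon `P`:
a polygonal path inside `P` from `s` to `t`, with consecutive vertices distinct, with no
three consecutive vertices collinear, whose length realizes the geodesic distance. -/
def SimplePolygon.IsGeodesicChain (P : SimplePolygon) (s t : Pt) (L : List Pt) : Prop :=
  L.head? = some s ∧ L.getLast? = some t ∧ List.Chain' (· ≠ ·) L ∧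
  (∀ i, i + 2 < L.length →
      det2 (L.getD (i + 1) 0 - L.getD i 0) (L.getD (i + 2) 0 - L.getD i 0) ≠ 0) ∧
  polylineSet L ⊆ P.region ∧
  ENNReal.ofReal (polylineLen L) = P.geodDist s t

/-- The triple `(p,q,r)` is in geodesic counterclockwise order with respect to `P`:
writing the geodesics `π(p,q) = ⟨p = v₀, …, v_k = q⟩` and `π(p,r) = ⟨p = u₀, …, u_{k'} = r⟩`
and taking the smallest index `i > 0` with `v_i ≠ u_i`, we have
`det (v_i − v_{i−1}, u_i − v_{i−1}) > 0`. -/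
def geodesicCCW (P : SimplePolygon) (p q r : Pt) : Prop :=
  ∃ L M : List Pt, P.IsGeodesicChain p q L ∧ P.IsGeodesicChain p r M ∧
    ∃ i : ℕ, 0 < i ∧ (∀ j < i, L[j]? = M[j]?) ∧ L[i]? ≠ M[i]? ∧
      ∃ a b c : Pt, L[i - 1]? = some a ∧ L[i]? = some b ∧ M[i]? = some c ∧
        0 < det2 (b - a) (c - a)

/-- The triple `(p,q,r)` is in geodesic clockwise order with respect to `P`. -/
def geodesicCW (P : SimplePolygon) (p q r : Pt) : Prop :=
  ∃ L M : List Pt, P.IsGeodesicChain p q L ∧ P.IsGeodesicChain p r M ∧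
    ∃ i : ℕ, 0 < i ∧ (∀ j < i, L[j]? = M[j]?) ∧ L[i]? ≠ M[i]? ∧
      ∃ a b c : Pt, L[i - 1]? = some a ∧ L[i]? = some b ∧ M[i]? = some c ∧
        det2 (b - a) (c - a) < 0

/-- `C ⊆ P` is geodesically convex: for all `p, q ∈ C` the geodesic connecting them
stays inside `C`. -/
def GeodesicallyConvex (P : SimplePolygon) (C : Set Pt) : Prop :=
  C ⊆ P.region ∧ ∀ p ∈ C, ∀ q ∈ C, ∀ L, P.IsGeodesicChain p q L → polylineSet L ⊆ C

/-- The geodesic hull `CH_P(U)`: the intersection of all geodesically convex subsets of `P`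
containing `U`. -/
def geodesicHull (P : SimplePolygon) (U : Set Pt) : Set Pt :=
  ⋂₀ {C | GeodesicallyConvex P C ∧ U ⊆ C}

/-- `E_P(S)`: the set of points of `S` lying on the (topological) boundary of the geodesic
hull of `S` with respect to `P`. -/
def extremeSet (P : SimplePolygon) (S : Set Pt) : Set Pt :=
  {x ∈ S | x ∈ frontier (geodesicHull P S)}

/-- `B` is separable from `R`: there is a simple polygon with at most `|B|` convex vertices
whose interior contains all points of `R` and which contains no point of `B`. -/
def Separable (B R : Finset Pt) : Prop :=
  ∃ P : SimplePolygon, P.CCW ∧ P.numConvex ≤ B.card ∧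
    (∀ r ∈ R, r ∈ P.interior) ∧ ∀ b ∈ B, b ∉ P.region

/-- `L` is a list of points starting at `a` and ending at `b`. -/
def PathFrom (a b : Pt) (L : List Pt) : Prop := L.head? = some a ∧ L.getLast? = some b

theorem PathFrom.singleton (a : Pt) : PathFrom a a [a] := ⟨rfl, rfl⟩

theorem PathFrom.cons {b c : Pt} {L : List Pt} (a : Pt) (h : PathFrom b c L) :
    PathFrom a c (a :: L) := by
  refine ⟨rfl, ?_⟩
  cases L with
  | nil => simp [PathFrom] at h
  | cons x l => simpa [List.getLast?_cons_cons] using h.2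

theorem PathFrom.induction {b : Pt} {motive : Pt → List Pt → Prop} (single : motive b [b])
    (cons : ∀ a c l, PathFrom c b (c :: l) → motive c (c :: l) → motive a (a :: c :: l)) :
    ∀ {L : List Pt} {a : Pt}, PathFrom a b L → motive a L
  | [], a, h => by simp [PathFrom] at h
  | [x], a, h => by
    obtain ⟨h1, h2⟩ := h
    simp only [List.head?_cons, List.getLast?_singleton, Option.some.injEq] at h1 h2
    subst h1; subst h2; exact single
  | x :: y :: l, a, h => by
    obtain ⟨h1, h2⟩ := h
    simp only [List.head?_cons, Option.some.injEq] at h1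
    subst h1
    have h3 : PathFrom y b (y :: l) := ⟨rfl, by simpa [List.getLast?_cons_cons] using h2⟩
    exact cons x y l h3 (PathFrom.induction single cons h3)

theorem PathFrom.exists_eq_cons {a b : Pt} {L : List Pt} (h : PathFrom a b L) :
    ∃ l, L = a :: l := by
  refine PathFrom.induction (motive := fun a L => ∃ l, L = a :: l) ⟨[], rfl⟩ ?_ h
  intro a c l _ _
  exact ⟨_, rfl⟩

theorem polylineSet_cons {b c : Pt} {L : List Pt} (a : Pt) (h : PathFrom b c L) :
    polylineSet (a :: L) = segment ℝ a b ∪ polylineSet L := by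
  obtain ⟨l, rfl⟩ := h.exists_eq_cons
  rfl

theorem polylineLen_cons {b c : Pt} {L : List Pt} (a : Pt) (h : PathFrom b c L) :
    polylineLen (a :: L) = dist a b + polylineLen L := by
  obtain ⟨l, rfl⟩ := h.exists_eq_cons
  rfl

theorem PathFrom.append {a b c d : Pt} {L M : List Pt} (h : PathFrom a b L)
    (h' : PathFrom c d M) :
    PathFrom a d (L ++ M) ∧
      polylineSet (L ++ M) = polylineSet L ∪ (segment ℝ b c ∪ polylineSet M) ∧
      polylineLen (L ++ M) = polylineLen L + (dist b c + polylineLen M) := by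
  refine PathFrom.induction (motive := fun a L => PathFrom a d (L ++ M) ∧
      polylineSet (L ++ M) = polylineSet L ∪ (segment ℝ b c ∪ polylineSet M) ∧
      polylineLen (L ++ M) = polylineLen L + (dist b c + polylineLen M)) ?_ ?_ h
  · refine ⟨h'.cons b, ?_, ?_⟩
    · rw [List.singleton_append, polylineSet_cons b h']
      have : ({b} : Set Pt) ⊆ segment ℝ b c := by simpa using left_mem_segment ℝ b c
      change _ = {b} ∪ _
      rw [← Set.union_assoc, Set.union_eq_self_of_subset_left this]
    · rw [List.singleton_append, polylineLen_cons b h']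
      simp [polylineLen]
  · rintro a x l - ⟨h1, h2, h3⟩
    refine ⟨h1.cons a, ?_, ?_⟩
    · rw [List.cons_append, polylineSet_cons a h1, h2]
      simp only [polylineSet, Set.union_assoc]
    · rw [List.cons_append, polylineLen_cons a h1, h3]
      simp only [polylineLen]; ring

theorem polylineLen_nonneg : ∀ L : List Pt, 0 ≤ polylineLen L
  | [] => le_rfl
  | [_] => le_rfl
  | _ :: b :: l => add_nonneg dist_nonneg (polylineLen_nonneg (b :: l))

theorem isCompact_segment (a b : Pt) : IsCompact (segment ℝ a b) := by
  rw [segment_eq_image]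
  exact isCompact_Icc.image (by fun_prop)

theorem isCompact_polylineSet : ∀ L : List Pt, IsCompact (polylineSet L)
  | [] => isCompact_empty
  | [_] => isCompact_singleton
  | a :: b :: l => (isCompact_segment a b).union (isCompact_polylineSet (b :: l))

theorem PathFrom.left_mem {a b : Pt} {L : List Pt} (h : PathFrom a b L) : a ∈ polylineSet L := by
  refine PathFrom.induction (motive := fun a L => a ∈ polylineSet L) rfl ?_ h
  intro a c l _ _
  exact Or.inl (left_mem_segment ℝ a c)

theorem PathFrom.right_mem {a b : Pt} {L : List Pt} (h : PathFrom a b L) :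
    b ∈ polylineSet L := by
  refine PathFrom.induction (motive := fun _ L => b ∈ polylineSet L) rfl ?_ h
  intro a c l _ h
  exact Or.inr h

theorem PathFrom.isPreconnected {a b : Pt} {L : List Pt} (h : PathFrom a b L) :
    IsPreconnected (polylineSet L) := by
  refine PathFrom.induction (motive := fun _ L => IsPreconnected (polylineSet L))
    isPreconnected_singleton ?_ h
  intro a c l hl h
  exact IsPreconnected.union c (right_mem_segment ℝ a c) hl.left_mem
    (convex_segment a c).isPreconnected h

theorem segment_subset_of_mem {a b x y : Pt} (hx : x ∈ segment ℝ a b) (hy : y ∈ segment ℝ a b) :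
    segment ℝ x y ⊆ segment ℝ a b :=
  (convex_segment a b).segment_subset hx hy

theorem exists_first_mem_segment {S : Set Pt} (hS : IsClosed S) {a c : Pt}
    (h : (segment ℝ a c ∩ S).Nonempty) :
    ∃ y ∈ segment ℝ a c, y ∈ S ∧ ∀ x ∈ segment ℝ a y, x ∈ S → x = y := by
  obtain ⟨y, ⟨hy, hyS⟩, hmin⟩ := ((isCompact_segment a c).inter_right hS).exists_isMinOn h
    (f := fun x => dist a x) (by fun_prop)
  refine ⟨y, hy, hyS, fun x hx hxS => ?_⟩
  have h1 : dist a y ≤ dist a x :=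
    hmin ⟨segment_subset_of_mem (left_mem_segment ℝ a c) hy hx, hxS⟩
  have h2 := dist_add_dist_of_mem_segment hx
  exact dist_le_zero.1 (by linarith)

/-- The first point of a polygonal path which lies in a closed set. -/
theorem PathFrom.exists_first_mem {S : Set Pt} (hS : IsClosed S) {a b : Pt} {L : List Pt}
    (h : PathFrom a b L) (ha : a ∉ S) (hne : (polylineSet L ∩ S).Nonempty) :
    ∃ m y X Y, PathFrom a m X ∧ PathFrom y b Y ∧ y ∈ S ∧ (∀ x ∈ polylineSet X, x ∉ S) ∧
      (∀ x ∈ segment ℝ m y, x ∈ S → x = y) ∧ polylineSet X ⊆ polylineSet L ∧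
      segment ℝ m y ⊆ polylineSet L ∧ polylineSet Y ⊆ polylineSet L ∧
      polylineLen X + (dist m y + polylineLen Y) = polylineLen L := by
  revert ha hne
  refine PathFrom.induction (motive := fun a L => a ∉ S → (polylineSet L ∩ S).Nonempty →
    ∃ m y X Y, PathFrom a m X ∧ PathFrom y b Y ∧ y ∈ S ∧ (∀ x ∈ polylineSet X, x ∉ S) ∧
      (∀ x ∈ segment ℝ m y, x ∈ S → x = y) ∧ polylineSet X ⊆ polylineSet L ∧
      segment ℝ m y ⊆ polylineSet L ∧ polylineSet Y ⊆ polylineSet L ∧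
      polylineLen X + (dist m y + polylineLen Y) = polylineLen L) ?_ ?_ h
  · rintro hb ⟨x, hx, hxS⟩
    rw [polylineSet, Set.mem_singleton_iff] at hx
    exact absurd (hx ▸ hxS) hb
  · intro a c l hl ih ha hne
    by_cases hac : (segment ℝ a c ∩ S).Nonempty
    · obtain ⟨y, hy, hyS, hfirst⟩ := exists_first_mem_segment hS hac
      refine ⟨a, y, [a], y :: c :: l, .singleton a, hl.cons y, hyS, ?_, hfirst, ?_, ?_, ?_, ?_⟩
      · rintro x hx
        rw [polylineSet, Set.mem_singleton_iff] at hx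
        rwa [hx]
      · rintro x hx
        rw [polylineSet, Set.mem_singleton_iff] at hx
        exact Or.inl (hx ▸ left_mem_segment ℝ a c)
      · exact (segment_subset_of_mem (left_mem_segment ℝ a c) hy).trans Set.subset_union_left
      · exact Set.union_subset_union_left _
          (segment_subset_of_mem hy (right_mem_segment ℝ a c))
      · have := dist_add_dist_of_mem_segment hy
        simp only [polylineLen]; linarith
    · have hac' : ∀ x ∈ segment ℝ a c, x ∉ S := fun x hx hxS => hac ⟨x, hx, hxS⟩
      obtain ⟨m, y, X, Y, h1, h2, h3, h4, h5, h6, h7, h8, h9⟩ :=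
        ih (hac' c (right_mem_segment ℝ a c)) (by
          obtain ⟨x, hx | hx, hxS⟩ := hne
          · exact absurd hxS (hac' x hx)
          · exact ⟨x, hx, hxS⟩)
      refine ⟨m, y, a :: X, Y, h1.cons a, h2, h3, ?_, h5, ?_, h7.trans Set.subset_union_right,
        h8.trans Set.subset_union_right, ?_⟩
      · rw [polylineSet_cons a h1]
        rintro x (hx | hx)
        · exact hac' x hx
        · exact h4 x hx
      · rw [polylineSet_cons a h1]
        exact Set.union_subset_union_right _ h6
      · rw [polylineLen_cons a h1]
        simp only [polylineLen]; linarith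

/-- Splitting a polygonal path at one of its points. -/
theorem PathFrom.exists_split {a b y : Pt} {L : List Pt} (h : PathFrom a b L)
    (hy : y ∈ polylineSet L) :
    ∃ X Y, PathFrom a y X ∧ PathFrom y b Y ∧ polylineSet X ⊆ polylineSet L ∧
      polylineSet Y ⊆ polylineSet L ∧ polylineLen X + polylineLen Y = polylineLen L := by
  by_cases hay : a = y
  · subst hay
    refine ⟨[a], L, .singleton a, h, ?_, subset_rfl, by simp [polylineLen]⟩
    simpa [polylineSet] using hy
  · obtain ⟨m, y', X, Y, h1, h2, h3, -, -, h6, h7, h8, h9⟩ :=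
      h.exists_first_mem (S := {y}) isClosed_singleton hay ⟨y, hy, rfl⟩
    rw [Set.mem_singleton_iff] at h3
    subst h3
    obtain ⟨e1, e2, e3⟩ := h1.append (PathFrom.singleton y')
    refine ⟨X ++ [y'], Y, e1, h2, ?_, h8, ?_⟩
    · rw [e2]
      exact Set.union_subset h6 (Set.union_subset h7 (by simpa [polylineSet] using hy))
    · rw [e3]; simp only [polylineLen]; linarith

/-- `L` is a shortest polygonal path from `a` to `b` inside `K`. -/
structure Shortest (K : Set Pt) (a b : Pt) (L : List Pt) : Prop where
  path : PathFrom a b L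
  subset : polylineSet L ⊆ K
  le : ∀ M, PathFrom a b M → polylineSet M ⊆ K → polylineLen L ≤ polylineLen M

theorem Shortest.middle {K : Set Pt} {a b x y : Pt} {L X Z Y : List Pt} (h : Shortest K a b L)
    (hX : PathFrom a x X) (hZ : PathFrom x y Z) (hY : PathFrom y b Y)
    (hXK : polylineSet X ⊆ K) (hZK : polylineSet Z ⊆ K) (hYK : polylineSet Y ⊆ K)
    (hlen : polylineLen X + polylineLen Z + polylineLen Y ≤ polylineLen L) :
    Shortest K x y Z := by
  refine ⟨hZ, hZK, fun M hM hMK => ?_⟩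
  obtain ⟨e1, e2, e3⟩ := hM.append hY
  obtain ⟨f1, f2, f3⟩ := hX.append e1
  have := h.le _ f1 (by
    rw [f2, e2, segment_same, segment_same]
    refine Set.union_subset hXK (Set.union_subset ?_ (Set.union_subset hMK
      (Set.union_subset ?_ hYK)))
    · simpa using hXK hX.right_mem
    · simpa using hYK hY.left_mem)
  rw [f3, e3, dist_self, dist_self] at this
  linarith

theorem Shortest.notMem_tail {K : Set Pt} {a b c : Pt} {L Y : List Pt} (h : Shortest K a b L)
    (hac : a ≠ c) (hY : PathFrom c b Y) (hYK : polylineSet Y ⊆ K)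
    (hlen : dist a c + polylineLen Y ≤ polylineLen L) : a ∉ polylineSet Y := by
  intro ha
  obtain ⟨X, Z, -, h2, -, h4, h5⟩ := hY.exists_split ha
  have h6 := h.le Z h2 (h4.trans hYK)
  have := polylineLen_nonneg X
  have := dist_pos.2 hac
  linarith

/-- The first nondegenerate edge of a polygonal path. -/
theorem PathFrom.exists_first_edge {a b : Pt} {L : List Pt} (h : PathFrom a b L) (hab : a ≠ b) :
    ∃ c Y, c ≠ a ∧ PathFrom c b Y ∧ segment ℝ a c ⊆ polylineSet L ∧
      polylineSet Y ⊆ polylineSet L ∧ dist a c + polylineLen Y = polylineLen L := by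
  revert hab
  refine PathFrom.induction (motive := fun a L => a ≠ b →
    ∃ c Y, c ≠ a ∧ PathFrom c b Y ∧ segment ℝ a c ⊆ polylineSet L ∧
      polylineSet Y ⊆ polylineSet L ∧ dist a c + polylineLen Y = polylineLen L)
    (fun h => absurd rfl h) ?_ h
  intro a c l hl ih hab
  by_cases hca : c = a
  · subst hca
    obtain ⟨d, Y, h1, h2, h3, h4, h5⟩ := ih hab
    exact ⟨d, Y, h1, h2, h3.trans Set.subset_union_right, h4.trans Set.subset_union_right, by
      simp only [polylineLen, dist_self, zero_add]; exact h5⟩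
  · exact ⟨c, c :: l, hca, hl, Set.subset_union_left, Set.subset_union_right, rfl⟩

theorem mem_segment_of_shortest {K : Set Pt} {m v w : Pt} (h : Shortest K m w [m, v, w])
    {δ : ℝ} (hδ : 0 < δ) (hδ1 : δ ≤ 1)
    (hK : segment ℝ (v + δ • (m - v)) (v + δ • (w - v)) ⊆ K) : v ∈ segment ℝ m w := by
  have key : ∀ x : Pt, v + δ • (x - v) ∈ segment ℝ v x := fun x => by
    rw [segment_eq_image']
    exact ⟨δ, ⟨hδ.le, hδ1⟩, rfl⟩
  have hsub := h.subset
  simp only [polylineSet, Set.union_subset_iff] at hsub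
  have h1 := h.le [m, v + δ • (m - v), v + δ • (w - v), w] ⟨rfl, rfl⟩ (by
    simp only [polylineSet, Set.union_subset_iff]
    refine ⟨?_, hK, ?_, hsub.2.2⟩
    · rw [segment_symm]
      refine (segment_subset_of_mem (key m) (right_mem_segment ℝ v m)).trans ?_
      rw [segment_symm]; exact hsub.1
    · exact (segment_subset_of_mem (key w) (right_mem_segment ℝ v w)).trans hsub.2.1)
  have e1 := dist_add_dist_of_mem_segment (key m)
  have e2 := dist_add_dist_of_mem_segment (key w)
  have e3 : dist v (v + δ • (m - v)) = δ * dist m v := by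
    rw [dist_eq_norm, dist_eq_norm, ← norm_neg]
    simp [norm_smul, abs_of_pos hδ]
  have e4 : dist v (v + δ • (w - v)) = δ * dist v w := by
    rw [dist_eq_norm, dist_comm, dist_eq_norm, ← norm_neg]
    simp [norm_smul, abs_of_pos hδ]
  have e5 : dist (v + δ • (m - v)) (v + δ • (w - v)) = δ * dist m w := by
    rw [dist_add_left, dist_smul₀, dist_sub_right, Real.norm_of_nonneg hδ.le]
  simp only [polylineLen] at h1
  rw [e5, dist_comm m (v + _)] at h1
  rw [dist_comm v m] at e1
  have h2 : δ * (dist m v + dist v w) ≤ δ * dist m w := by linarith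
  have h3 := le_of_mul_le_mul_left h2 hδ
  rw [mem_segment_iff_wbtw, ← dist_add_dist_eq_iff]
  exact le_antisymm h3 (dist_triangle _ _ _)

theorem segment_subset_union_of_mem {a b c : Pt} (h : b ∈ segment ℝ a c) :
    segment ℝ a c ⊆ segment ℝ a b ∪ segment ℝ b c := by
  rw [segment_eq_image'] at h ⊢
  obtain ⟨s, ⟨hs0, hs1⟩, rfl⟩ := h
  rintro x ⟨t, ⟨ht0, ht1⟩, rfl⟩
  have key : ∀ u ∈ Set.Icc (0 : ℝ) 1, ∀ w ∈ Set.Icc (0 : ℝ) 1, ∀ r ∈ segment ℝ u w,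
      a + r • (c - a) ∈ segment ℝ (a + u • (c - a)) (a + w • (c - a)) := by
    rintro u - w - r ⟨x, y, hx, hy, hxy, rfl⟩
    refine ⟨x, y, hx, hy, hxy, ?_⟩
    simp only [smul_add, add_smul, smul_smul, smul_eq_mul]
    rw [add_add_add_comm, ← add_smul, hxy, one_smul]
  rcases le_total t s with hts | hts
  · left
    have := key 0 (by simp) s ⟨hs0, hs1⟩ t (by rw [segment_eq_Icc hs0]; exact ⟨ht0, hts⟩)
    simpa using this
  · right
    have := key s ⟨hs0, hs1⟩ 1 (by simp) t (by rw [segment_eq_Icc hs1]; exact ⟨hts, ht1⟩)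
    simpa using this

theorem segment_subset_of_det2_eq_zero {a b c : Pt} (h : det2 (b - a) (c - a) = 0) :
    segment ℝ a c ⊆ segment ℝ a b ∪ segment ℝ b c := by
  have hcol : Collinear ℝ ({a, b, c} : Set Pt) := by
    by_cases hab : b = a
    · subst hab; simpa using collinear_pair ℝ b c
    rw [collinear_iff_of_mem (p₀ := a) (by simp)]
    refine ⟨b - a, ?_⟩
    simp only [Set.mem_insert_iff, Set.mem_singleton_iff, forall_eq_or_imp, forall_eq]
    refine ⟨⟨0, by simp⟩, ⟨1, by simp⟩, ?_⟩
    simp only [det2, PiLp.sub_apply] at h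
    have hn : (b 0 - a 0) ^ 2 + (b 1 - a 1) ^ 2 ≠ 0 := by
      intro h0
      apply hab
      have h1 : b 0 - a 0 = 0 := by nlinarith [sq_nonneg (b 0 - a 0), sq_nonneg (b 1 - a 1)]
      have h2 : b 1 - a 1 = 0 := by nlinarith [sq_nonneg (b 0 - a 0), sq_nonneg (b 1 - a 1)]
      ext i; fin_cases i
      · exact sub_eq_zero.1 h1
      · exact sub_eq_zero.1 h2
    refine ⟨((c 0 - a 0) * (b 0 - a 0) + (c 1 - a 1) * (b 1 - a 1)) /
      ((b 0 - a 0) ^ 2 + (b 1 - a 1) ^ 2), ?_⟩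
    ext i; fin_cases i
    · simp
      field_simp
      linear_combination -(b 1 - a 1) * h
    · simp
      field_simp
      linear_combination (b 0 - a 0) * h
  rcases hcol.wbtw_or_wbtw_or_wbtw with h1 | h1 | h1
  · rw [← mem_segment_iff_wbtw] at h1
    exact segment_subset_union_of_mem h1
  · rw [← mem_segment_iff_wbtw] at h1
    refine fun x hx => Or.inl ?_
    exact segment_subset_of_mem (left_mem_segment ℝ a b) (segment_symm ℝ b a ▸ h1) hx
  · rw [← mem_segment_iff_wbtw] at h1
    refine fun x hx => Or.inr ?_
    exact segment_subset_of_mem (segment_symm ℝ c b ▸ h1) (right_mem_segment ℝ b c) hx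

namespace SimplePolygon

variable (P : SimplePolygon)

theorem isCompact_boundary : IsCompact P.boundary :=
  (Finset.range P.n).isCompact_biUnion fun _ _ => isCompact_segment _ _

theorem interior_subset_region : P.interior ⊆ P.region := Set.subset_union_right

variable {P}

theorem mem_boundary {x : Pt} :
    x ∈ P.boundary ↔ ∃ i < P.n, x ∈ segment ℝ (P.vtx i) (P.vtx (i + 1)) := by
  simp [boundary]

theorem vertexSet_subset_boundary : P.vertexSet ⊆ P.boundary := by
  rintro x ⟨i, hi, rfl⟩
  exact mem_boundary.2 ⟨i, hi, left_mem_segment ℝ _ _⟩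

theorem not_isBounded_of_notMem_region {z : Pt} (hz : z ∉ P.region) :
    ¬ Bornology.IsBounded (connectedComponentIn P.boundaryᶜ z) := by
  intro h
  exact hz (Or.inr ⟨fun hb => hz (Or.inl hb), h⟩)

theorem connectedComponentIn_disjoint_region {z : Pt} (hz : z ∉ P.region) :
    ∀ x ∈ connectedComponentIn P.boundaryᶜ z, x ∉ P.region := by
  rintro x hx (hb | ⟨-, hb⟩)
  · exact connectedComponentIn_subset _ _ hx hb
  · rw [← connectedComponentIn_eq hx] at hb
    exact not_isBounded_of_notMem_region hz hb

theorem mem_connectedComponentIn_of_notMem_region {z : Pt} (hz : z ∉ P.region) :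
    z ∈ connectedComponentIn P.boundaryᶜ z :=
  mem_connectedComponentIn fun hb => hz (Or.inl hb)

theorem isClosed_region : IsClosed P.region := by
  rw [← isOpen_compl_iff, isOpen_iff_mem_nhds]
  intro z hz
  have ho : IsOpen (connectedComponentIn P.boundaryᶜ z) :=
    P.isCompact_boundary.isClosed.isOpen_compl.connectedComponentIn
  exact Filter.mem_of_superset
    (ho.mem_nhds (mem_connectedComponentIn_of_notMem_region hz))
    (connectedComponentIn_disjoint_region hz)

theorem isBounded_region : Bornology.IsBounded P.region := by
  obtain ⟨R, hR⟩ := P.isCompact_boundary.isBounded.subset_closedBall (0 : Pt)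
  refine (Metric.isBounded_closedBall (x := (0 : Pt)) (r := max R 0)).subset ?_
  rintro x (hx | ⟨hx, hb⟩)
  · exact Metric.closedBall_subset_closedBall (le_max_left _ _) (hR hx)
  · by_contra hxR
    simp only [Metric.mem_closedBall, dist_zero_right, not_le, max_lt_iff] at hxR
    have hsub : (fun s : ℝ => s • x) '' Set.Ici 1 ⊆ connectedComponentIn P.boundaryᶜ x := by
      refine IsPreconnected.subset_connectedComponentIn
        (isPreconnected_Ici.image _ (by fun_prop)) ⟨1, by simp, by simp⟩ ?_
      rintro _ ⟨s, hs, rfl⟩ hsb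
      have := hR hsb
      rw [Set.mem_Ici] at hs
      rw [Metric.mem_closedBall, dist_zero_right, norm_smul, Real.norm_of_nonneg (by linarith)]
        at this
      nlinarith
    obtain ⟨R', hR'⟩ := (hb.subset hsub).subset_closedBall (0 : Pt)
    have hmem : (max 1 (R' / ‖x‖ + 1)) • x ∈ Metric.closedBall (0 : Pt) R' :=
      hR' ⟨_, Set.mem_Ici.2 (le_max_left _ _), rfl⟩
    rw [Metric.mem_closedBall, dist_zero_right, norm_smul,
      Real.norm_of_nonneg (le_trans zero_le_one (le_max_left _ _))] at hmem
    have h2 : (R' / ‖x‖ + 1) * ‖x‖ ≤ max 1 (R' / ‖x‖ + 1) * ‖x‖ :=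
      mul_le_mul_of_nonneg_right (le_max_right _ _) (norm_nonneg _)
    have h3 : (R' / ‖x‖ + 1) * ‖x‖ = R' + ‖x‖ := by
      field_simp [hxR.2.ne']
    linarith [hxR.2]

theorem isCompact_region : IsCompact P.region :=
  Metric.isCompact_of_isClosed_isBounded isClosed_region isBounded_region

theorem mem_region_of_segment {u z : Pt} (hz : z ∈ P.region)
    (h : ∀ x ∈ segment ℝ u z, x ∉ P.boundary) : u ∈ P.region := by
  by_contra hu
  have hsub : segment ℝ u z ⊆ connectedComponentIn P.boundaryᶜ u :=
    (convex_segment u z).isPreconnected.subset_connectedComponentIn (left_mem_segment ℝ u z) h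
  exact connectedComponentIn_disjoint_region hu z (hsub (right_mem_segment ℝ u z)) hz

/-- A point has a neighbourhood meeting only those edges which contain the point. -/
theorem exists_ball_mem_edge (x : Pt) : ∃ ε > 0, ∀ w ∈ Metric.ball x ε, ∀ i < P.n,
    w ∈ segment ℝ (P.vtx i) (P.vtx (i + 1)) → x ∈ segment ℝ (P.vtx i) (P.vtx (i + 1)) := by
  have h : ∀ᶠ w in nhds x, ∀ i ∈ Finset.range P.n,
      w ∈ segment ℝ (P.vtx i) (P.vtx (i + 1)) → x ∈ segment ℝ (P.vtx i) (P.vtx (i + 1)) := by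
    rw [Filter.eventually_all_finset]
    intro i _
    by_cases hx : x ∈ segment ℝ (P.vtx i) (P.vtx (i + 1))
    · exact Filter.Eventually.of_forall fun _ _ => hx
    · filter_upwards [(isCompact_segment _ _).isClosed.isOpen_compl.mem_nhds hx] with w hw hw'
      exact absurd hw' hw
  obtain ⟨ε, hε, h'⟩ := Metric.eventually_nhds_iff_ball.1 h
  exact ⟨ε, hε, fun w hw i hi => h' w hw i (Finset.mem_range.2 hi)⟩

theorem exists_ball_segment_subset (x : Pt) :
    ∃ ε > 0, ∀ z ∈ P.region, z ∈ Metric.ball x ε → segment ℝ x z ⊆ P.region := by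
  obtain ⟨ε, hε, h⟩ := P.exists_ball_mem_edge x
  refine ⟨ε, hε, fun z hz hzx u hu => ?_⟩
  by_cases hw : ∀ w ∈ segment ℝ u z, w ∉ P.boundary
  · exact mem_region_of_segment hz hw
  · push Not at hw
    obtain ⟨w, hw, hwb⟩ := hw
    obtain ⟨i, hi, hwi⟩ := mem_boundary.1 hwb
    have hwx : w ∈ segment ℝ x z :=
      segment_subset_of_mem hu (right_mem_segment ℝ x z) hw
    have hwball : w ∈ Metric.ball x ε :=
      (convex_ball x ε).segment_subset (Metric.mem_ball_self hε) hzx hwx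
    have hxi := h w hwball i hi hwi
    refine Or.inl (mem_boundary.2 ⟨i, hi, segment_subset_of_mem hxi hwi ?_⟩)
    rw [mem_segment_iff_wbtw] at *
    exact hu.trans_right_left hw

theorem existsUnique_edge {v : Pt} (hv : v ∉ P.vertexSet) {i j : ℕ} (hi : i < P.n)
    (hj : j < P.n) (hvi : v ∈ segment ℝ (P.vtx i) (P.vtx (i + 1)))
    (hvj : v ∈ segment ℝ (P.vtx j) (P.vtx (j + 1))) : i = j := by
  by_contra hij
  have hfin : {i | i < P.n ∧ v ∈ segment ℝ (P.vtx i) (P.vtx (i + 1))}.Finite :=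
    (Set.finite_lt_nat P.n).subset fun i hi => hi.1
  have hsub : {i, j} ⊆ {i | i < P.n ∧ v ∈ segment ℝ (P.vtx i) (P.vtx (i + 1))} :=
    Set.insert_subset ⟨hi, hvi⟩ (Set.singleton_subset_iff.2 ⟨hj, hvj⟩)
  have h2 := Set.ncard_le_ncard hsub hfin
  rw [Set.ncard_pair hij] at h2
  exact hv (P.vtx_of_two v (le_antisymm (P.simple v) h2))

theorem exists_ball_convex {v : Pt} (hv : v ∉ P.vertexSet) :
    ∃ ε > 0, ∀ z ∈ P.region, z ∈ Metric.ball v ε → ∀ w ∈ P.region, w ∈ Metric.ball v ε →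
      segment ℝ z w ⊆ P.region := by
  obtain ⟨ε, hε, h⟩ := P.exists_ball_mem_edge v
  refine ⟨ε, hε, fun z hz hzv w hw hwv u hu => ?_⟩
  have hball := (convex_ball v ε).segment_subset hzv hwv
  by_cases hz' : ∀ x ∈ segment ℝ u z, x ∉ P.boundary
  · exact mem_region_of_segment hz hz'
  by_cases hw' : ∀ x ∈ segment ℝ u w, x ∉ P.boundary
  · exact mem_region_of_segment hw hw'
  push Not at hz' hw'
  obtain ⟨x, hx, hxb⟩ := hz'
  obtain ⟨y, hy, hyb⟩ := hw'
  obtain ⟨i, hi, hxi⟩ := mem_boundary.1 hxb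
  obtain ⟨j, hj, hyj⟩ := mem_boundary.1 hyb
  have hij := existsUnique_edge hv hi hj
    (h x (hball (segment_subset_of_mem hu (left_mem_segment ℝ z w) hx)) i hi hxi)
    (h y (hball (segment_subset_of_mem hu (right_mem_segment ℝ z w) hy)) j hj hyj)
  subst hij
  refine Or.inl (mem_boundary.2 ⟨i, hi, segment_subset_of_mem hxi hyj ?_⟩)
  rw [mem_segment_iff_wbtw] at *
  exact (hu.trans_left_right hx.symm).trans_right_left hy

/-- Being joined by a finite chain of segments inside `K`. -/
def ChainJoined (K : Set Pt) : Pt → Pt → Prop :=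
  Relation.ReflTransGen fun x y => segment ℝ x y ⊆ K

theorem ChainJoined.symm {K : Set Pt} {a b : Pt} (h : ChainJoined K a b) : ChainJoined K b a :=
  haveI : Std.Symm fun x y : Pt => segment ℝ x y ⊆ K := ⟨fun x y h => by rwa [segment_symm]⟩
  Relation.ReflTransGen.stdSymm.symm a b h

theorem ChainJoined.exists_pathFrom {K : Set Pt} {a b : Pt} (h : ChainJoined K a b)
    (hb : b ∈ K) : ∃ L, PathFrom a b L ∧ polylineSet L ⊆ K := by
  induction h using Relation.ReflTransGen.head_induction_on with
  | refl => exact ⟨[b], .singleton b, by simpa [polylineSet] using hb⟩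
  | head h _ ih =>
    obtain ⟨L, hL, hLK⟩ := ih
    exact ⟨_, hL.cons _, by rw [polylineSet_cons _ hL]; exact Set.union_subset h hLK⟩

theorem chainJoined_vtx (i : ℕ) (hi : i < P.n) :
    ChainJoined P.region (P.vtx 0) (P.vtx i) := by
  induction i with
  | zero => exact .refl
  | succ i ih =>
    refine (ih (by omega)).tail fun x hx => Or.inl (mem_boundary.2 ⟨i, by omega, hx⟩)

theorem chainJoined_of_mem {x : Pt} (hx : x ∈ P.region) :
    ChainJoined P.region (P.vtx 0) x := by
  have hbd : ∀ x ∈ P.boundary, ChainJoined P.region (P.vtx 0) x := by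
    intro x hx
    obtain ⟨i, hi, hxi⟩ := mem_boundary.1 hx
    refine (chainJoined_vtx i hi).tail fun y hy => Or.inl (mem_boundary.2 ⟨i, hi, ?_⟩)
    exact segment_subset_of_mem (left_mem_segment ℝ _ _) hxi hy
  have h0 : P.vtx 0 ∈ P.boundary :=
    vertexSet_subset_boundary ⟨0, by have := P.three_le; omega, rfl⟩
  obtain ⟨y, -, hyb, hfirst⟩ := exists_first_mem_segment P.isCompact_boundary.isClosed
    (a := x) (c := P.vtx 0) ⟨_, right_mem_segment ℝ _ _, h0⟩
  refine (hbd y hyb).tail fun u hu => ?_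
  by_cases huy : u = y
  · exact huy ▸ Or.inl hyb
  refine mem_region_of_segment hx fun w hw hwb => huy ?_
  rw [segment_symm] at hu
  have hwy := hfirst w (segment_subset_of_mem hu (left_mem_segment ℝ x y) hw) hwb
  subst hwy
  rw [mem_segment_iff_wbtw] at hu hw
  exact (hu.swap_right_iff.1 hw.symm)

theorem exists_pathFrom {a b : Pt} (ha : a ∈ P.region) (hb : b ∈ P.region) :
    ∃ L, PathFrom a b L ∧ polylineSet L ⊆ P.region :=
  ChainJoined.exists_pathFrom ((chainJoined_of_mem ha).symm.trans (chainJoined_of_mem hb)) hb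

end SimplePolygon

theorem inner_eq_coords (a b : Pt) : ⟪a, b⟫ = a 0 * b 0 + a 1 * b 1 := by
  simp [PiLp.inner_apply, Fin.sum_univ_two, mul_comm]

theorem norm_sq_eq_coords (a : Pt) : ‖a‖ ^ 2 = a 0 ^ 2 + a 1 ^ 2 := by
  simp [EuclideanSpace.norm_sq_eq, Fin.sum_univ_two]

/-- The complex number with the coordinates of a point of the plane. -/
def toComplex (a : Pt) : ℂ := ⟨a 0, a 1⟩

theorem toComplex_ne_zero {a : Pt} (h : a ≠ 0) : toComplex a ≠ 0 := by
  intro h0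
  apply h
  have h1 := congrArg Complex.re h0
  have h2 := congrArg Complex.im h0
  ext i; fin_cases i
  · exact h1
  · exact h2

/-- The signed angle, in `(-π, π]`, under which the segment from `u` to `w` is seen from `z`. -/
def viewAngle (z u w : Pt) : ℝ :=
  Complex.arg (toComplex (w - z) * (starRingEnd ℂ) (toComplex (u - z)))

theorem toComplex_mul_conj (a b : Pt) :
    toComplex b * (starRingEnd ℂ) (toComplex a) = ⟨⟪a, b⟫, det2 a b⟩ := by
  apply Complex.ext
  · simp [toComplex, inner_eq_coords]; ring
  · simp [toComplex, det2]; ring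

theorem mem_segment_of_det2_eq_zero {z u w : Pt} (h : det2 (u - z) (w - z) = 0)
    (h' : ⟪u - z, w - z⟫ ≤ 0) : z ∈ segment ℝ u w := by
  rw [mem_segment_iff_wbtw, ← dist_add_dist_eq_iff]
  have e1 := norm_sq_eq_coords (u - z)
  have e2 := norm_sq_eq_coords (w - z)
  have e3 : dist u w ^ 2 = ‖u - z‖ ^ 2 - 2 * ⟪u - z, w - z⟫ + ‖w - z‖ ^ 2 := by
    rw [dist_eq_norm, ← norm_sub_sq_real, sub_sub_sub_cancel_right]
  have e4 : ⟪u - z, w - z⟫ ^ 2 = (‖u - z‖ * ‖w - z‖) ^ 2 := by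
    rw [mul_pow, e1, e2, inner_eq_coords]
    rw [det2] at h
    linear_combination -(((u - z) 0 * (w - z) 1 - (u - z) 1 * (w - z) 0)) * h
  have e5 : -⟪u - z, w - z⟫ = ‖u - z‖ * ‖w - z‖ := by
    rw [← neg_sq] at e4
    exact (sq_eq_sq₀ (by linarith) (by positivity)).1 e4
  rw [dist_eq_norm u z, dist_comm z w, dist_eq_norm w z]
  refine (sq_eq_sq₀ (by positivity) dist_nonneg).1 ?_
  rw [e3]; linear_combination -2 * e5

theorem continuousAt_viewAngle {z u w : Pt} (h : z ∉ segment ℝ u w) :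
    ContinuousAt (fun z => viewAngle z u w) z := by
  have h1 : toComplex (w - z) * (starRingEnd ℂ) (toComplex (u - z)) ∈ Complex.slitPlane := by
    rw [toComplex_mul_conj, Complex.mem_slitPlane_iff]
    by_contra hc
    push Not at hc
    exact h (mem_segment_of_det2_eq_zero hc.2 hc.1)
  refine ContinuousAt.comp (g := Complex.arg) (Complex.continuousAt_arg h1) ?_
  simp only [toComplex_mul_conj]
  have : (fun z : Pt => (⟨⟪u - z, w - z⟫, det2 (u - z) (w - z)⟩ : ℂ)) =
      fun z => (⟪u - z, w - z⟫ : ℂ) + (det2 (u - z) (w - z) : ℂ) * Complex.I := by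
    funext z
    exact Complex.mk_eq_add_mul_I _ _
  rw [this]
  unfold det2
  fun_prop

theorem coe_viewAngle {z u w : Pt} (hu : z ≠ u) (hw : z ≠ w) :
    (viewAngle z u w : Real.Angle) =
      Complex.arg (toComplex (w - z)) - Complex.arg (toComplex (u - z)) := by
  rw [viewAngle, Complex.arg_mul_coe_angle (toComplex_ne_zero (sub_ne_zero.2 hw.symm))
    (by simpa using toComplex_ne_zero (sub_ne_zero.2 hu.symm)), Complex.arg_conj_coe_angle,
    ← sub_eq_add_neg]

/-- The argument of `u - z` relative to the direction `h`. -/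
def relArg (z h u : Pt) : ℝ :=
  Complex.arg (toComplex (u - z) * (starRingEnd ℂ) (toComplex h))

theorem viewAngle_eq_sub {z h u w : Pt} (hu : 0 < ⟪u - z, h⟫) (hw : 0 < ⟪w - z, h⟫) :
    viewAngle z u w = relArg z h w - relArg z h u := by
  have hh : h ≠ 0 := by rintro rfl; simp at hu
  have key : ∀ x : Pt, 0 < ⟪x - z, h⟫ → |relArg z h x| < Real.pi / 2 ∧
      toComplex (x - z) * (starRingEnd ℂ) (toComplex h) ≠ 0 := by
    intro x hx
    have hre : 0 < (toComplex (x - z) * (starRingEnd ℂ) (toComplex h)).re := by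
      rw [toComplex_mul_conj, real_inner_comm]; exact hx
    exact ⟨Complex.abs_arg_lt_pi_div_two_iff.2 (Or.inl hre), fun h0 => by simp [h0] at hre⟩
  obtain ⟨u1, u2⟩ := key u hu
  obtain ⟨w1, w2⟩ := key w hw
  rw [abs_lt] at u1 w1
  have hconj : Complex.arg ((starRingEnd ℂ) (toComplex (u - z) * (starRingEnd ℂ) (toComplex h)))
      = -relArg z h u := by
    rw [Complex.arg_conj, if_neg]
    · rfl
    · change relArg z h u ≠ _
      linarith [Real.pi_pos]
  have hmul := Complex.arg_mul w2 ((map_ne_zero (starRingEnd ℂ)).2 u2) (by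
    rw [hconj]; change relArg z h w + _ ∈ _
    constructor <;> linarith)
  rw [hconj] at hmul
  rw [sub_eq_add_neg]
  refine Eq.trans ?_ hmul
  have : toComplex (w - z) * (starRingEnd ℂ) (toComplex h) *
      (starRingEnd ℂ) (toComplex (u - z) * (starRingEnd ℂ) (toComplex h)) =
      toComplex (w - z) * (starRingEnd ℂ) (toComplex (u - z)) *
        ((Complex.normSq (toComplex h) : ℝ) : ℂ) := by
    rw [Complex.normSq_eq_conj_mul_self, map_mul, Complex.conj_conj]; ring
  rw [this, Complex.arg_mul_real (Complex.normSq_pos.2 (toComplex_ne_zero hh)), viewAngle]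

theorem viewAngle_pos {z u w : Pt} (h : 0 < det2 (u - z) (w - z)) : 0 < viewAngle z u w := by
  rw [viewAngle, toComplex_mul_conj]
  refine lt_of_le_of_ne (Complex.arg_nonneg_iff.2 h.le) fun h0 => ?_
  have := (Complex.arg_eq_zero_iff.1 h0.symm).2
  exact h.ne' this

theorem viewAngle_neg {z u w : Pt} (h : det2 (u - z) (w - z) < 0) : viewAngle z u w < 0 := by
  rw [viewAngle, toComplex_mul_conj]
  exact Complex.arg_neg_iff.2 h

/-- The total angle swept by a polygonal path as seen from `z`. -/
def sweep (z : Pt) : List Pt → ℝ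
  | [] => 0
  | [_] => 0
  | a :: b :: l => viewAngle z a b + sweep z (b :: l)

theorem continuousAt_sweep {z : Pt} : ∀ {L : List Pt}, z ∉ polylineSet L →
    ContinuousAt (fun z => sweep z L) z
  | [], _ => continuousAt_const
  | [_], _ => continuousAt_const
  | a :: b :: l, h => by
    simp only [polylineSet, Set.mem_union, not_or] at h
    exact (continuousAt_viewAngle h.1).add (continuousAt_sweep h.2)

theorem PathFrom.coe_sweep {z a b : Pt} {L : List Pt} (h : PathFrom a b L)
    (hz : z ∉ polylineSet L) : (sweep z L : Real.Angle) =
      Complex.arg (toComplex (b - z)) - Complex.arg (toComplex (a - z)) := by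
  revert hz
  refine PathFrom.induction (motive := fun a L => z ∉ polylineSet L →
    (sweep z L : Real.Angle) =
      Complex.arg (toComplex (b - z)) - Complex.arg (toComplex (a - z))) ?_ ?_ h
  · intro _; simp [sweep]
  · intro a c l hl ih hz
    simp only [polylineSet, Set.mem_union, not_or] at hz
    rw [sweep, Real.Angle.coe_add, ih hz.2, coe_viewAngle]
    · abel
    · rintro rfl; exact hz.1 (left_mem_segment ℝ _ _)
    · rintro rfl; exact hz.1 (right_mem_segment ℝ _ _)

theorem PathFrom.sweep_eq_sub {z d a b : Pt} {L : List Pt} (h : PathFrom a b L)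
    (hz : ∀ x ∈ polylineSet L, 0 < ⟪x - z, d⟫) : sweep z L = relArg z d b - relArg z d a := by
  revert hz
  refine PathFrom.induction (motive := fun a L => (∀ x ∈ polylineSet L, 0 < ⟪x - z, d⟫) →
    sweep z L = relArg z d b - relArg z d a) ?_ ?_ h
  · intro _; simp [sweep]
  · intro a c l hl ih hz
    rw [sweep, ih fun x hx => hz x (Or.inr hx),
      viewAngle_eq_sub (hz a (Or.inl (left_mem_segment ℝ a c)))
        (hz c (Or.inl (right_mem_segment ℝ a c)))]
    ring

/-- The total angle swept around `z` by the closed path which follows `L` and returns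
along `M`. -/
def loopSweep (z : Pt) (L M : List Pt) : ℝ := sweep z L - sweep z M

theorem loopSweep_eq_zero {z d a b : Pt} {L M : List Pt} (hL : PathFrom a b L)
    (hM : PathFrom a b M) (h : ∀ x ∈ polylineSet L ∪ polylineSet M, 0 < ⟪x - z, d⟫) :
    loopSweep z L M = 0 := by
  rw [loopSweep, hL.sweep_eq_sub fun x hx => h x (Or.inl hx),
    hM.sweep_eq_sub fun x hx => h x (Or.inr hx), sub_self]

theorem loopSweep_eq_of_isPreconnected {a b x y : Pt} {L M : List Pt} (hL : PathFrom a b L)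
    (hM : PathFrom a b M) {S : Set Pt} (hS : IsPreconnected S)
    (h : ∀ z ∈ S, z ∉ polylineSet L ∪ polylineSet M) (hx : x ∈ S) (hy : y ∈ S) :
    loopSweep x L M = loopSweep y L M := by
  refine hS.constant_of_mapsTo (T := (AddSubgroup.zmultiples (2 * Real.pi) : Set ℝ))
    (f := fun z => loopSweep z L M) ?_ ?_ ?_ hx hy
  · exact SetLike.isDiscrete_iff_discreteTopology.2 inferInstance
  · intro z hz
    have := h z hz
    rw [Set.mem_union, not_or] at this
    exact ((continuousAt_sweep this.1).sub (continuousAt_sweep this.2)).continuousWithinAt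
  · intro z hz
    have := h z hz
    rw [Set.mem_union, not_or] at this
    have h0 : (loopSweep z L M : Real.Angle) = ((0 : ℝ) : Real.Angle) := by
      rw [loopSweep, Real.Angle.coe_sub, hL.coe_sweep this.1, hM.coe_sweep this.2, sub_self,
        Real.Angle.coe_zero]
    obtain ⟨k, hk⟩ := Real.Angle.angle_eq_iff_two_pi_dvd_sub.1 h0
    refine AddSubgroup.mem_zmultiples_iff.2 ⟨k, ?_⟩
    simp only [zsmul_eq_mul]
    linarith

theorem PathFrom.sweep_append {a b : Pt} {L M : List Pt} (z : Pt) (h : PathFrom a b L) :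
    sweep z (L ++ M) = sweep z L + sweep z (b :: M) := by
  refine PathFrom.induction (motive := fun a L => sweep z (L ++ M) = sweep z L + sweep z (b :: M))
    ?_ ?_ h
  · simp [sweep]
  · intro a c l _ ih
    simp only [List.cons_append, sweep] at ih ⊢
    rw [ih]; ring

theorem SimplePolygon.loopSweep_eq_zero_of_notMem_region {P : SimplePolygon} {z a b : Pt}
    {L M : List Pt} (hL : PathFrom a b L) (hM : PathFrom a b M)
    (hLK : polylineSet L ⊆ P.region) (hMK : polylineSet M ⊆ P.region) (hz : z ∉ P.region) :
    loopSweep z L M = 0 := by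
  obtain ⟨R, hR⟩ := P.isBounded_region.subset_closedBall (0 : Pt)
  have hfar : ∃ z₁ ∈ connectedComponentIn P.boundaryᶜ z, R < ‖z₁‖ := by
    by_contra! hc
    exact not_isBounded_of_notMem_region hz
      (Metric.isBounded_closedBall.subset fun x hx => mem_closedBall_zero_iff.2 (hc x hx))
  obtain ⟨z₁, hz₁, hR₁⟩ := hfar
  rw [loopSweep_eq_of_isPreconnected hL hM isPreconnected_connectedComponentIn
    (fun x hx hx' => connectedComponentIn_disjoint_region hz x hx
      (Set.union_subset hLK hMK hx')) (mem_connectedComponentIn_of_notMem_region hz) hz₁]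
  refine loopSweep_eq_zero (d := -z₁) hL hM fun x hx => ?_
  have hxR : ‖x‖ ≤ R := mem_closedBall_zero_iff.1 (hR (Set.union_subset hLK hMK hx))
  have h1 := real_inner_le_norm x z₁
  have h2 : ‖x‖ * ‖z₁‖ < ‖z₁‖ * ‖z₁‖ :=
    mul_lt_mul_of_pos_right (hxR.trans_lt hR₁) ((norm_nonneg x).trans_lt (hxR.trans_lt hR₁))
  rw [inner_neg_right, inner_sub_left, real_inner_self_eq_norm_mul_norm]
  linarith

theorem convex_setOf_inner_sub_pos (v h : Pt) : Convex ℝ {u : Pt | 0 < ⟪u - v, h⟫} := by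
  have : {u : Pt | 0 < ⟪u - v, h⟫} = {u : Pt | ⟪v, h⟫ < innerₗ Pt h u} := by
    ext u
    rw [Set.mem_ofPred_eq, Set.mem_ofPred_eq, innerₗ_apply_apply, real_inner_comm, real_inner_comm h v,
      inner_sub_right, sub_pos]
  rw [this]
  exact convex_halfSpace_gt (innerₗ Pt h).isLinear _

theorem convex_setOf_le_det2 (v d : Pt) (c D : ℝ) :
    Convex ℝ {u : Pt | c ≤ D * det2 (u - v) d} := by
  intro p hp q hq s t hs ht hst
  simp only [Set.mem_ofPred_eq] at hp hq ⊢
  have : D * det2 (s • p + t • q - v) d = s * (D * det2 (p - v) d) + t * (D * det2 (q - v) d) := by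
    simp only [det2, PiLp.sub_apply, PiLp.add_apply, PiLp.smul_apply, smul_eq_mul]
    linear_combination D * (v 0 * d 1 - v 1 * d 0) * hst
  rw [this]
  calc c = s * c + t * c := by rw [← add_mul, hst, one_mul]
    _ ≤ _ := add_le_add (mul_le_mul_of_nonneg_left hp hs) (mul_le_mul_of_nonneg_left hq ht)

/-- A corner of a closed path inside the polygon which is exposed in some direction can be
cut off inside the polygon. -/
theorem SimplePolygon.exists_corner_cut {P : SimplePolygon} {a y m v w h : Pt}
    {X Y M : List Pt} (hX : PathFrom a m X) (hY : PathFrom w y Y) (hM : PathFrom a y M)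
    (hXK : polylineSet X ⊆ P.region) (hYK : polylineSet Y ⊆ P.region)
    (hMK : polylineSet M ⊆ P.region) (hmK : segment ℝ m v ⊆ P.region)
    (hwK : segment ℝ v w ⊆ P.region) (hvX : v ∉ polylineSet X) (hvY : v ∉ polylineSet Y)
    (hvM : v ∉ polylineSet M)
    (hpos : ∀ u ∈ polylineSet X ∪ polylineSet Y ∪ polylineSet M, 0 < ⟪u - v, h⟫) :
    ∃ δ : ℝ, 0 < δ ∧ δ ≤ 1 ∧ segment ℝ (v + δ • (m - v)) (v + δ • (w - v)) ⊆ P.region := by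
  by_cases hD : det2 (m - v) (w - v) = 0
  · refine ⟨1, one_pos, le_rfl, ?_⟩
    rw [one_smul, one_smul, add_sub_cancel, add_sub_cancel]
    refine (segment_subset_of_det2_eq_zero (b := v) ?_).trans (Set.union_subset hmK hwK)
    simp only [det2, PiLp.sub_apply] at hD ⊢
    linear_combination -hD
  set e := m - v with he
  set f := w - v with hf
  set D := det2 e f with hDdef
  have hcl : IsClosed (polylineSet X ∪ polylineSet Y ∪ polylineSet M) :=
    (((isCompact_polylineSet X).union (isCompact_polylineSet Y)).union
      (isCompact_polylineSet M)).isClosed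
  have hvE : v ∉ polylineSet X ∪ polylineSet Y ∪ polylineSet M := by
    simp [hvX, hvY, hvM]
  obtain ⟨δ₀, hδ₀, hball⟩ := Metric.isOpen_iff.1 hcl.isOpen_compl v hvE
  have hs : 0 < ‖e‖ + ‖f‖ + 1 := by positivity
  obtain ⟨δ, hδ, hδ1, hδs⟩ : ∃ δ > 0, δ ≤ 1 ∧ δ * (‖e‖ + ‖f‖) < δ₀ := by
    refine ⟨min 1 (δ₀ / (‖e‖ + ‖f‖ + 1)), by positivity, min_le_left _ _, ?_⟩
    have h1 : min 1 (δ₀ / (‖e‖ + ‖f‖ + 1)) * (‖e‖ + ‖f‖ + 1) ≤ δ₀ :=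
      (mul_le_mul_of_nonneg_right (min_le_right _ _) hs.le).trans_eq (div_mul_cancel₀ _ hs.ne')
    have h2 : 0 < min 1 (δ₀ / (‖e‖ + ‖f‖ + 1)) := by positivity
    linarith
  have hm : 0 < ⟪m - v, h⟫ := hpos m (Or.inl (Or.inl hX.right_mem))
  have hw : 0 < ⟪w - v, h⟫ := hpos w (Or.inl (Or.inr hY.left_mem))
  have key : ∀ x t : ℝ, 0 < x → 0 < t → x + t < δ → v + (x • e + t • f) ∈ P.region := by
    intro x t hx ht hxt
    by_contra hz
    set z := v + (x • e + t • f) with hzdef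
    set a' := v + δ • e with ha'
    set b' := v + δ • f with hb'
    have pair : ∀ p q : Pt, PathFrom p q [p, q] := fun p q => (PathFrom.singleton q).cons p
    have ha'seg : a' ∈ segment ℝ m v := by
      rw [segment_symm, segment_eq_image']
      exact ⟨δ, ⟨hδ.le, hδ1⟩, rfl⟩
    have hb'seg : b' ∈ segment ℝ v w := by
      rw [segment_eq_image']
      exact ⟨δ, ⟨hδ.le, hδ1⟩, rfl⟩
    have hma : segment ℝ m a' ⊆ P.region :=
      (segment_subset_of_mem (left_mem_segment ℝ m v) ha'seg).trans hmK
    have hav : segment ℝ a' v ⊆ P.region :=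
      (segment_subset_of_mem ha'seg (right_mem_segment ℝ m v)).trans hmK
    have hvb : segment ℝ v b' ⊆ P.region :=
      (segment_subset_of_mem (left_mem_segment ℝ v w) hb'seg).trans hwK
    have hbw : segment ℝ b' w ⊆ P.region :=
      (segment_subset_of_mem hb'seg (right_mem_segment ℝ v w)).trans hwK
    obtain ⟨q1, q2, -⟩ := ((pair v b').cons a').append hY
    obtain ⟨C1, C2, -⟩ := hX.append q1
    obtain ⟨r1, r2, -⟩ := (pair a' b').append hY
    obtain ⟨D1, D2, -⟩ := hX.append r1
    have hC : loopSweep z (X ++ ([a', v, b'] ++ Y)) M = 0 := by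
      refine loopSweep_eq_zero_of_notMem_region C1 hM ?_ hMK hz
      rw [C2, q2]
      refine Set.union_subset hXK (Set.union_subset hma (Set.union_subset
        (Set.union_subset hav (Set.union_subset hvb ?_)) (Set.union_subset hbw hYK)))
      exact Set.singleton_subset_iff.2 (hwK hb'seg)
    have hC' : loopSweep z (X ++ ([a', b'] ++ Y)) M = 0 := by
      have hvz : loopSweep v (X ++ ([a', b'] ++ Y)) M = loopSweep z (X ++ ([a', b'] ++ Y)) M := by
        refine loopSweep_eq_of_isPreconnected D1 hM (convex_segment v z).isPreconnected ?_
          (left_mem_segment ℝ v z) (right_mem_segment ℝ v z)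
        intro u hu hu'
        have hH : u ∉ {u : Pt | δ * D ^ 2 ≤ D * det2 (u - v) (f - e)} := by
          rw [segment_eq_image'] at hu
          obtain ⟨s, ⟨hs0, hs1⟩, rfl⟩ := hu
          have : D * det2 (v + s • (z - v) - v) (f - e) = s * (x + t) * D ^ 2 := by
            simp only [hzdef, hDdef, det2, PiLp.sub_apply, PiLp.add_apply, PiLp.smul_apply,
              smul_eq_mul]
            ring
          rw [Set.mem_ofPred_eq, this, not_le]
          refine mul_lt_mul_of_pos_right ?_ (by positivity)
          nlinarith
        have hB : u ∉ polylineSet X ∪ polylineSet Y ∪ polylineSet M := by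
          apply hball
          have hzb : z ∈ Metric.ball v δ₀ := by
            rw [Metric.mem_ball, dist_eq_norm, hzdef, add_sub_cancel_left]
            refine ((norm_add_le _ _).trans_eq ?_).trans_lt
              (lt_of_le_of_lt (?_ : x * ‖e‖ + t * ‖f‖ ≤ _) hδs)
            · rw [norm_smul, norm_smul, Real.norm_of_nonneg hx.le, Real.norm_of_nonneg ht.le]
            · have := mul_le_mul_of_nonneg_right (by linarith : x ≤ δ) (norm_nonneg e)
              have := mul_le_mul_of_nonneg_right (by linarith : t ≤ δ) (norm_nonneg f)
              linarith
          exact (convex_ball v δ₀).segment_subset (Metric.mem_ball_self hδ₀) hzb hu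
        have hmH : m ∈ {u : Pt | δ * D ^ 2 ≤ D * det2 (u - v) (f - e)} := by
          have : D * det2 (m - v) (f - e) = 1 * D ^ 2 := by
            simp only [← he, hDdef, det2, PiLp.sub_apply]
            ring
          rw [Set.mem_ofPred_eq, this]
          exact mul_le_mul_of_nonneg_right hδ1 (by positivity)
        have hwH : w ∈ {u : Pt | δ * D ^ 2 ≤ D * det2 (u - v) (f - e)} := by
          have : D * det2 (w - v) (f - e) = 1 * D ^ 2 := by
            simp only [← hf, hDdef, det2, PiLp.sub_apply]
            ring
          rw [Set.mem_ofPred_eq, this]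
          exact mul_le_mul_of_nonneg_right hδ1 (by positivity)
        have haH : a' ∈ {u : Pt | δ * D ^ 2 ≤ D * det2 (u - v) (f - e)} := by
          rw [Set.mem_ofPred_eq]
          refine le_of_eq ?_
          simp only [ha', hDdef, det2, PiLp.sub_apply, PiLp.add_apply, PiLp.smul_apply,
            smul_eq_mul]
          ring
        have hbH : b' ∈ {u : Pt | δ * D ^ 2 ≤ D * det2 (u - v) (f - e)} := by
          rw [Set.mem_ofPred_eq]
          refine le_of_eq ?_
          simp only [hb', hDdef, det2, PiLp.sub_apply, PiLp.add_apply, PiLp.smul_apply,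
            smul_eq_mul]
          ring
        have hconv := convex_setOf_le_det2 v (f - e) (δ * D ^ 2) D
        rw [D2, r2] at hu'
        simp only [Set.mem_union, not_or] at hB hu'
        rcases hu' with (hu' | hu' | (hu' | hu') | hu' | hu') | hu'
        · exact hB.1.1 hu'
        · exact hH (hconv.segment_subset hmH haH hu')
        · exact hH (hconv.segment_subset haH hbH hu')
        · exact hH (by rw [Set.mem_singleton_iff.1 hu']; exact hbH)
        · exact hH (hconv.segment_subset hbH hwH hu')
        · exact hB.1.2 hu'
        · exact hB.2 hu'
      rw [← hvz]
      have hconv := convex_setOf_inner_sub_pos v h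
      have haH : a' ∈ {u : Pt | 0 < ⟪u - v, h⟫} := by
        rw [Set.mem_ofPred_eq, ha', add_sub_cancel_left, real_inner_smul_left]
        positivity
      have hbH : b' ∈ {u : Pt | 0 < ⟪u - v, h⟫} := by
        rw [Set.mem_ofPred_eq, hb', add_sub_cancel_left, real_inner_smul_left]
        positivity
      refine loopSweep_eq_zero (d := h) D1 hM fun u hu' => ?_
      rw [D2, r2] at hu'
      simp only [Set.mem_union] at hu' hpos
      rcases hu' with (hu' | hu' | (hu' | hu') | hu' | hu') | hu'
      · exact hpos u (Or.inl (Or.inl hu'))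
      · exact hconv.segment_subset hm haH hu'
      · exact hconv.segment_subset haH hbH hu'
      · rw [Set.mem_singleton_iff.1 hu']; exact hbH
      · exact hconv.segment_subset hbH hw hu'
      · exact hpos u (Or.inl (Or.inr hu'))
      · exact hpos u (Or.inr hu')
    have hdiff : viewAngle z a' v + viewAngle z v b' - viewAngle z a' b' = 0 := by
      rw [loopSweep, hX.sweep_append] at hC hC'
      simp only [List.cons_append, List.nil_append, sweep] at hC hC'
      linarith
    have d1 : det2 (a' - z) (v - z) = -(D * (δ * t)) := by
      simp only [ha', hzdef, hDdef, det2, PiLp.sub_apply, PiLp.add_apply, PiLp.smul_apply,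
        smul_eq_mul]
      ring
    have d2 : det2 (v - z) (b' - z) = -(D * (δ * x)) := by
      simp only [hb', hzdef, hDdef, det2, PiLp.sub_apply, PiLp.add_apply, PiLp.smul_apply,
        smul_eq_mul]
      ring
    have d3 : det2 (a' - z) (b' - z) = D * (δ * (δ - x - t)) := by
      simp only [ha', hb', hzdef, hDdef, det2, PiLp.sub_apply, PiLp.add_apply, PiLp.smul_apply,
        smul_eq_mul]
      ring
    have p1 : 0 < δ * t := by positivity
    have p2 : 0 < δ * x := by positivity
    have p3 : 0 < δ * (δ - x - t) := mul_pos hδ (by linarith)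
    rcases lt_or_gt_of_ne hD with hneg | hpos'
    · have s1 := viewAngle_pos (d1 ▸ by nlinarith : 0 < det2 (a' - z) (v - z))
      have s2 := viewAngle_pos (d2 ▸ by nlinarith : 0 < det2 (v - z) (b' - z))
      have s3 := viewAngle_neg (d3 ▸ by nlinarith : det2 (a' - z) (b' - z) < 0)
      linarith
    · have s1 := viewAngle_neg (d1 ▸ by nlinarith : det2 (a' - z) (v - z) < 0)
      have s2 := viewAngle_neg (d2 ▸ by nlinarith : det2 (v - z) (b' - z) < 0)
      have s3 := viewAngle_pos (d3 ▸ by nlinarith : 0 < det2 (a' - z) (b' - z))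
      linarith
  refine ⟨δ / 2, by positivity, by linarith, ?_⟩
  have mem : ∀ q : Pt, v + (δ / 2) • (q - v) ∈ segment ℝ v q := fun q => by
    rw [segment_eq_image']
    exact ⟨δ / 2, ⟨by positivity, by linarith⟩, rfl⟩
  rw [segment_eq_image']
  rintro u ⟨s, ⟨hs0, hs1⟩, rfl⟩
  rcases hs0.eq_or_lt with rfl | hs0
  · simpa [he] using hmK (segment_symm ℝ v m ▸ mem m)
  rcases hs1.eq_or_lt with rfl | hs1
  · simpa [hf] using hwK (mem w)
  have := key ((1 - s) * (δ / 2)) (s * (δ / 2)) (mul_pos (by linarith) (by positivity))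
    (mul_pos hs0 (by positivity)) (by linarith)
  convert this using 1
  module

theorem SimplePolygon.false_of_exposed {P : SimplePolygon} {a y v h : Pt} {L M : List Pt}
    (hL : Shortest P.region a y L) (hM : PathFrom a y M) (hMK : polylineSet M ⊆ P.region)
    (hva : v ≠ a) (hvy : v ≠ y) (hvL : v ∈ polylineSet L) (hvM : v ∉ polylineSet M)
    (hpos : ∀ u ∈ polylineSet L ∪ polylineSet M, u ≠ v → 0 < ⟪u - v, h⟫) : False := by
  obtain ⟨m, v', X, B, hX, hB, hv', hXv, -, hXL, hmv, hBL, hlen⟩ :=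
    hL.path.exists_first_mem (isClosed_singleton (x := v)) (by simpa using hva.symm)
      ⟨v, hvL, rfl⟩
  rw [Set.mem_singleton_iff] at hv'
  subst hv'
  have hvX : v' ∉ polylineSet X := fun hx => hXv _ hx rfl
  have pair : ∀ p q : Pt, PathFrom p q [p, q] := fun p q => (PathFrom.singleton q).cons p
  have segK : ∀ {p q : Pt}, segment ℝ p q ⊆ polylineSet L → polylineSet [p, q] ⊆ P.region :=
    fun hpq => Set.union_subset (hpq.trans hL.subset)
      (Set.singleton_subset_iff.2 (hL.subset (hpq (right_mem_segment ℝ _ _))))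
  have hBs : Shortest P.region v' y B := by
    obtain ⟨e1, e2, e3⟩ := hX.append (pair m v')
    refine hL.middle e1 hB (PathFrom.singleton y) ?_ (hBL.trans hL.subset) ?_ ?_
    · rw [e2, segment_same]
      exact Set.union_subset (hXL.trans hL.subset) (Set.union_subset
        (Set.singleton_subset_iff.2 (hL.subset (hXL hX.right_mem))) (segK hmv))
    · exact Set.singleton_subset_iff.2 (hL.subset hL.path.right_mem)
    · rw [e3]; simp only [polylineLen, dist_self]; linarith
  obtain ⟨w, Y, hwv, hY, hvw, hYB, hlenB⟩ := hB.exists_first_edge hvy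
  have hYK : polylineSet Y ⊆ P.region := hYB.trans (hBL.trans hL.subset)
  have hvY : v' ∉ polylineSet Y := hBs.notMem_tail hwv.symm hY hYK hlenB.le
  have hcorner : Shortest P.region m w [m, v', w] := by
    refine hL.middle hX ((pair v' w).cons m) hY (hXL.trans hL.subset) ?_ hYK ?_
    · exact Set.union_subset (hmv.trans hL.subset) (segK (hvw.trans hBL))
    · simp only [polylineLen]; linarith
  obtain ⟨δ, hδ, hδ1, hcut⟩ := exists_corner_cut hX hY hM (hXL.trans hL.subset) hYK hMK
    (hmv.trans hL.subset) (hvw.trans (hBL.trans hL.subset)) hvX hvY hvM (h := h) (by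
      rintro u ((hu | hu) | hu)
      · exact hpos u (Or.inl (hXL hu)) fun h => hvX (h ▸ hu)
      · exact hpos u (Or.inl (hBL (hYB hu))) fun h => hvY (h ▸ hu)
      · exact hpos u (Or.inr hu) fun h => hvM (h ▸ hu))
  have hseg := mem_segment_of_shortest hcorner hδ hδ1 hcut
  have hm : 0 < ⟪m - v', h⟫ := hpos m (Or.inl (hXL hX.right_mem)) fun h => hvX (h ▸ hX.right_mem)
  have hw : 0 < ⟪w - v', h⟫ :=
    hpos w (Or.inl (hBL (hYB hY.left_mem))) fun h => hvY (h ▸ hY.left_mem)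
  have := (convex_setOf_inner_sub_pos v' h).segment_subset hm hw hseg
  simp at this

theorem Shortest.exists_det2_ne_zero {K : Set Pt} {a y : Pt} {L M : List Pt}
    (hL : Shortest K a y L) (hM : Shortest K a y M) (hay : a ≠ y)
    (hLM : polylineSet L ∩ polylineSet M ⊆ {a, y}) :
    ∃ z ∈ polylineSet L ∪ polylineSet M, det2 (y - a) (z - a) ≠ 0 := by
  by_contra! hc
  have hN : 0 < ⟪y - a, y - a⟫ := real_inner_self_pos.2 (sub_ne_zero.2 hay.symm)
  have hmid : ∀ {S : List Pt}, PathFrom a y S →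
      ∃ x ∈ polylineSet S, ⟪x - a, y - a⟫ = ⟪y - a, y - a⟫ / 2 := by
    intro S hS
    have := hS.isPreconnected.intermediate_value hS.left_mem hS.right_mem
      (f := fun x => ⟪x - a, y - a⟫) (by fun_prop)
    obtain ⟨x, hx, hx'⟩ := this (show ⟪y - a, y - a⟫ / 2 ∈ _ by
      simp only [sub_self, inner_zero_left]
      constructor <;> linarith)
    exact ⟨x, hx, hx'⟩
  obtain ⟨x₁, h₁, e₁⟩ := hmid hL.path
  obtain ⟨x₂, h₂, e₂⟩ := hmid hM.path
  have d₁ := hc x₁ (Or.inl h₁)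
  have d₂ := hc x₂ (Or.inr h₂)
  have heq : x₁ = x₂ := by
    have hi := e₁.trans e₂.symm
    rw [inner_eq_coords] at hN
    rw [inner_eq_coords, inner_eq_coords] at hi
    simp only [det2] at d₁ d₂
    have c0 : (x₁ - x₂) 0 = 0 := by
      refine (mul_eq_zero.1 (?_ : _ * (x₁ - x₂) 0 = 0)).resolve_left hN.ne'
      simp only [PiLp.sub_apply] at *
      linear_combination (y 0 - a 0) * hi - (y 1 - a 1) * d₁ + (y 1 - a 1) * d₂
    have c1 : (x₁ - x₂) 1 = 0 := by
      refine (mul_eq_zero.1 (?_ : _ * (x₁ - x₂) 1 = 0)).resolve_left hN.ne'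
      simp only [PiLp.sub_apply] at *
      linear_combination (y 1 - a 1) * hi + (y 0 - a 0) * d₁ - (y 0 - a 0) * d₂
    rw [← sub_eq_zero]
    ext i; fin_cases i
    · exact c0
    · exact c1
  rcases hLM ⟨h₁, heq ▸ h₂⟩ with rfl | h
  · rw [sub_self, inner_zero_left] at e₁
    linarith
  · rw [Set.mem_singleton_iff.1 h] at e₁
    linarith

/-- Every compact set containing a point off the line through `a` and `y` has a point, other than
`a` and `y`, exposed in some direction. -/
theorem exists_exposed {S : Set Pt} (hS : IsCompact S) {a y z : Pt} (hz : z ∈ S)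
    (hdet : det2 (y - a) (z - a) ≠ 0) :
    ∃ v ∈ S, v ≠ a ∧ v ≠ y ∧ ∃ h, ∀ u ∈ S, u ≠ v → 0 < ⟪u - v, h⟫ := by
  set n : Pt := det2 (y - a) (z - a) • !₂[-(y - a) 1, (y - a) 0] with hn
  have hdn : ⟪y - a, n⟫ = 0 := by
    rw [inner_eq_coords, hn]; simp; ring
  have hk : 0 < ⟪z - a, n⟫ := by
    have : ⟪z - a, n⟫ = det2 (y - a) (z - a) ^ 2 := by
      rw [inner_eq_coords, hn]
      simp only [det2, PiLp.smul_apply, smul_eq_mul]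
      simp
      ring
    rw [this]; positivity
  have hN : 0 < ‖y - a‖ := by
    rw [norm_pos_iff]
    intro h0
    simp [h0, det2] at hdet
  set c : Pt := a - (‖y - a‖ ^ 2 / ⟪z - a, n⟫) • n with hc
  have sq : ∀ x : Pt, ‖x - c‖ ^ 2 = ‖x - a‖ ^ 2 +
      2 * (‖y - a‖ ^ 2 / ⟪z - a, n⟫ * ⟪x - a, n⟫) + ‖(‖y - a‖ ^ 2 / ⟪z - a, n⟫) • n‖ ^ 2 := by
    intro x
    rw [hc, sub_sub_eq_add_sub, add_sub_right_comm, norm_add_sq_real, real_inner_smul_right]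
  obtain ⟨v, hv, hmax⟩ := hS.exists_isMaxOn ⟨z, hz⟩ (f := fun x => ‖x - c‖) (by fun_prop)
  have hvz : ‖z - c‖ ^ 2 ≤ ‖v - c‖ ^ 2 := pow_le_pow_left₀ (norm_nonneg _) (hmax hz) 2
  have hzsq := sq z
  rw [div_mul_cancel₀ _ hk.ne'] at hzsq
  have hz0 := sq_nonneg ‖z - a‖
  have hN2 : 0 < ‖y - a‖ ^ 2 := by positivity
  refine ⟨v, hv, ?_, ?_, c - v, fun u hu huv => ?_⟩
  · rintro rfl
    have := sq v
    rw [sub_self, norm_zero, inner_zero_left, mul_zero] at this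
    linarith
  · intro hvy
    have := sq y
    rw [hdn, mul_zero] at this
    rw [hvy] at hvz
    linarith
  · have h1 : ‖u - c‖ ^ 2 ≤ ‖v - c‖ ^ 2 := pow_le_pow_left₀ (norm_nonneg _) (hmax hu) 2
    have h2 : ‖u - c‖ ^ 2 = ‖u - v‖ ^ 2 - 2 * ⟪u - v, c - v⟫ + ‖c - v‖ ^ 2 := by
      rw [← norm_sub_sq_real, sub_sub_sub_cancel_right]
    rw [norm_sub_rev c v] at h2
    have h3 : 0 < ‖u - v‖ ^ 2 := by
      have := norm_pos_iff.2 (sub_ne_zero.2 huv)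
      positivity
    linarith

theorem SimplePolygon.false_of_bigon {P : SimplePolygon} {a y : Pt} {L M : List Pt}
    (hL : Shortest P.region a y L) (hM : Shortest P.region a y M) (hay : a ≠ y)
    (hLM : polylineSet L ∩ polylineSet M ⊆ {a, y}) : False := by
  obtain ⟨z, hz, hdet⟩ := hL.exists_det2_ne_zero hM hay hLM
  obtain ⟨v, hv, hva, hvy, h, hh⟩ :=
    exists_exposed ((isCompact_polylineSet L).union (isCompact_polylineSet M)) hz hdet
  have hnot : ¬ (v ∈ polylineSet L ∧ v ∈ polylineSet M) := fun hc =>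
    (hLM hc).elim hva hvy
  rcases hv with hv | hv
  · exact false_of_exposed hL hM.path hM.subset hva hvy hv (fun h => hnot ⟨hv, h⟩) hh
  · exact false_of_exposed hM hL.path hL.subset hva hvy hv (fun h => hnot ⟨h, hv⟩)
      (by rwa [Set.union_comm] at hh)

theorem exists_segment_param (a c : Pt) : ∃ g : ℝ → Pt, (∀ x ≤ 0, g x = a) ∧
    g (dist a c) = c ∧ (∀ x ≤ dist a c, g x ∈ segment ℝ a c) ∧
    ∀ x y, x ≤ y → y ≤ dist a c → dist (g x) (g y) ≤ y - x := by
  rcases eq_or_ne a c with rfl | hac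
  · exact ⟨fun _ => a, fun _ _ => rfl, rfl, fun _ _ => left_mem_segment ℝ a a, fun x y hxy _ => by
      rw [dist_self]; linarith⟩
  have hd : 0 < dist a c := dist_pos.2 hac
  refine ⟨fun x => AffineMap.lineMap a c (max 0 x / dist a c), fun x hx => ?_, ?_, fun x hx => ?_,
    fun x y hxy _ => ?_⟩
  · simp [max_eq_left hx]
  · simp [hd.ne']
  · rw [segment_eq_image_lineMap]
    exact ⟨_, ⟨by positivity, (div_le_one hd).2 (max_le hd.le hx)⟩, rfl⟩
  · rw [dist_lineMap_lineMap, Real.dist_eq, ← sub_div, abs_div, abs_of_pos hd,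
      div_mul_cancel₀ _ hd.ne', abs_sub_comm, abs_of_nonneg (sub_nonneg.2 (max_le_max_left 0 hxy))]
    rcases max_cases 0 x with h | h <;> rcases max_cases 0 y with h' | h' <;> linarith

theorem PathFrom.exists_param {a b : Pt} {L : List Pt} (h : PathFrom a b L) :
    ∃ f : ℝ → Pt, (∀ x ≤ 0, f x = a) ∧ (∀ x, polylineLen L ≤ x → f x = b) ∧
      (∀ x, f x ∈ polylineSet L) ∧ ∀ x y, x ≤ y → dist (f x) (f y) ≤ y - x := by
  refine PathFrom.induction (motive := fun a L => ∃ f : ℝ → Pt, (∀ x ≤ 0, f x = a) ∧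
    (∀ x, polylineLen L ≤ x → f x = b) ∧ (∀ x, f x ∈ polylineSet L) ∧
      ∀ x y, x ≤ y → dist (f x) (f y) ≤ y - x) ?_ ?_ h
  · exact ⟨fun _ => b, fun _ _ => rfl, fun _ _ => rfl, fun _ => rfl, fun x y hxy => by
      rw [dist_self]; linarith⟩
  · rintro a c l hl ⟨f, f0, f1, f2, f3⟩
    obtain ⟨g, g0, g1, g2, g3⟩ := exists_segment_param a c
    have hlen := polylineLen_nonneg (c :: l)
    have hd : 0 ≤ dist a c := dist_nonneg
    have e1 : ∀ x, x ≤ dist a c → (if x ≤ dist a c then g x else f (x - dist a c)) = g x :=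
      fun x hx => if_pos hx
    have e2 : ∀ x, dist a c ≤ x →
        (if x ≤ dist a c then g x else f (x - dist a c)) = f (x - dist a c) := by
      intro x hx
      split_ifs with h
      · rw [le_antisymm h hx, g1, f0 _ (by simp)]
      · rfl
    refine ⟨fun x => if x ≤ dist a c then g x else f (x - dist a c), fun x hx => ?_,
      fun x hx => ?_, fun x => ?_, fun x y hxy => ?_⟩
    · simp only [e1 x (hx.trans hd)]
      exact g0 x hx
    · simp only [polylineLen] at hx
      simp only [e2 x (by linarith)]
      exact f1 _ (by linarith)
    · rcases le_total x (dist a c) with hx | hx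
      · simp only [e1 x hx]
        exact Or.inl (g2 x hx)
      · simp only [e2 x hx]
        exact Or.inr (f2 _)
    · dsimp only
      rcases le_total y (dist a c) with hy | hy
      · rw [e1 x (hxy.trans hy), e1 y hy]
        exact g3 x y hxy hy
      · rcases le_total x (dist a c) with hx | hx
        · rw [e1 x hx, e2 y hy]
          have h1 := g3 x _ hx le_rfl
          have h2 := f3 0 (y - dist a c) (by linarith)
          rw [f0 0 le_rfl] at h2
          rw [g1] at h1
          linarith [dist_triangle (g x) c (f (y - dist a c))]
        · rw [e2 x hx, e2 y hy]
          linarith [f3 (x - dist a c) (y - dist a c) (by linarith)]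

/-- A polygonal path has a parametrization on `[0, 1]` with Lipschitz constant its length. -/
theorem PathFrom.exists_lipschitz {a b : Pt} {L : List Pt} (h : PathFrom a b L) :
    ∃ g : ℝ → Pt, g 0 = a ∧ g 1 = b ∧ (∀ x, g x ∈ polylineSet L) ∧
      ∀ x y, dist (g x) (g y) ≤ polylineLen L * dist x y := by
  obtain ⟨f, f0, f1, f2, f3⟩ := h.exists_param
  have hlen := polylineLen_nonneg L
  refine ⟨fun x => f (polylineLen L * x), f0 _ (by simp), f1 _ (by simp), fun x => f2 _, ?_⟩
  have key : ∀ x y : ℝ, x ≤ y →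
      dist (f (polylineLen L * x)) (f (polylineLen L * y)) ≤ polylineLen L * dist x y := by
    intro x y hxy
    rw [dist_comm x, Real.dist_eq, abs_of_nonneg (sub_nonneg.2 hxy), mul_sub]
    exact f3 _ _ (mul_le_mul_of_nonneg_left hxy hlen)
  intro x y
  rcases le_total x y with h | h
  · exact key x y h
  · rw [dist_comm, dist_comm x]
    exact key y x h

theorem eVariationOn_le_of_dist_le {g : ℝ → Pt} {C : ℝ} (hC : 0 ≤ C)
    (h : ∀ x y, dist (g x) (g y) ≤ C * dist x y) :
    eVariationOn g (Set.Icc 0 1) ≤ ENNReal.ofReal C := by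
  have hlip : LipschitzWith C.toNNReal g :=
    LipschitzWith.of_dist_le_mul fun x y => by simpa [Real.coe_toNNReal _ hC] using h x y
  have h1 := (hlip.lipschitzOnWith (s := Set.univ)).comp_eVariationOn_le
    (g := (id : ℝ → ℝ)) (s := Set.Icc 0 1) (fun _ _ => Set.mem_univ _)
  have h2 := (monotone_id.monotoneOn Set.univ).eVariationOn_eq (f := (id : ℝ → ℝ))
    (Set.mem_univ (0 : ℝ)) (Set.mem_univ (1 : ℝ))
  rw [Set.univ_inter] at h2
  simp only [id_eq, sub_zero, ENNReal.ofReal_one, Function.comp_id] at h1 h2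
  exact h1.trans ((mul_le_mul_right h2.le _).trans_eq (mul_one _))

theorem SimplePolygon.mem_pathsIn_of_dist_le {P : SimplePolygon} {s t : Pt} {g : ℝ → Pt} {C : ℝ}
    (hC : 0 ≤ C) (h : ∀ x y, dist (g x) (g y) ≤ C * dist x y) (h0 : g 0 = s) (h1 : g 1 = t)
    (hK : ∀ x, g x ∈ P.region) : g ∈ P.pathsIn s t := by
  have hlip : LipschitzWith C.toNNReal g :=
    LipschitzWith.of_dist_le_mul fun x y => by simpa [Real.coe_toNNReal _ hC] using h x y
  refine ⟨hlip.continuous.continuousOn, h0, h1, ?_⟩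
  rintro _ ⟨x, -, rfl⟩
  exact hK x

theorem SimplePolygon.geodDist_le {P : SimplePolygon} {s t : Pt} {L : List Pt}
    (h : PathFrom s t L) (hK : polylineSet L ⊆ P.region) :
    P.geodDist s t ≤ ENNReal.ofReal (polylineLen L) := by
  obtain ⟨g, g0, g1, g2, g3⟩ := h.exists_lipschitz
  exact (iInf₂_le g (mem_pathsIn_of_dist_le (polylineLen_nonneg L) g3 g0 g1
    fun x => hK (g2 x))).trans (eVariationOn_le_of_dist_le (polylineLen_nonneg L) g3)

/-- Any path inside the polygon can be replaced by a polygonal path which is not longer. -/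
theorem SimplePolygon.exists_pathFrom_le_eVariationOn {P : SimplePolygon} {s t : Pt} {γ : ℝ → Pt}
    (hγ : γ ∈ P.pathsIn s t) : ∃ L, PathFrom s t L ∧ polylineSet L ⊆ P.region ∧
      ENNReal.ofReal (polylineLen L) ≤ eVariationOn γ (Set.Icc 0 1) := by
  obtain ⟨hc, h0, h1, hK⟩ := hγ
  have hmem : ∀ x ∈ Set.Icc (0 : ℝ) 1, γ x ∈ P.region := fun x hx => hK ⟨x, hx, rfl⟩
  let R : ℝ → ℝ → Prop := fun σ τ => ∃ L, PathFrom (γ σ) (γ τ) L ∧ polylineSet L ⊆ P.region ∧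
      ENNReal.ofReal (polylineLen L) ≤ eVariationOn γ (Set.Icc σ τ)
  have htrans : ∀ {σ τ ρ}, σ ≤ τ → τ ≤ ρ → R σ τ → R τ ρ → R σ ρ := by
    rintro σ τ ρ h1 h2 ⟨L, l1, l2, l3⟩ ⟨M, m1, m2, m3⟩
    obtain ⟨e1, e2, e3⟩ := l1.append m1
    refine ⟨_, e1, ?_, ?_⟩
    · rw [e2, segment_same]
      exact Set.union_subset l2 (Set.union_subset (Set.singleton_subset_iff.2 (l2 l1.right_mem)) m2)
    · rw [e3, dist_self, zero_add, ENNReal.ofReal_add (polylineLen_nonneg _) (polylineLen_nonneg _)]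
      have := eVariationOn.Icc_add_Icc γ h1 h2 (Set.mem_univ τ)
      simp only [Set.univ_inter] at this
      rw [← this]
      exact add_le_add l3 m3
  have hseg : ∀ {σ τ}, σ ≤ τ → segment ℝ (γ σ) (γ τ) ⊆ P.region → R σ τ := by
    intro σ τ h hs
    refine ⟨[γ σ, γ τ], (PathFrom.singleton _).cons _, Set.union_subset hs
      (Set.singleton_subset_iff.2 (hs (right_mem_segment ℝ _ _))), ?_⟩
    simp only [polylineLen, add_zero, ← edist_dist]
    exact eVariationOn.edist_le γ (Set.left_mem_Icc.2 h) (Set.right_mem_Icc.2 h)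
  have hloc : ∀ σ ∈ Set.Icc (0 : ℝ) 1, ∃ η > 0, ∀ τ ∈ Set.Icc (0 : ℝ) 1, |τ - σ| < η →
      segment ℝ (γ σ) (γ τ) ⊆ P.region := by
    intro σ hσ
    obtain ⟨ε, hε, hb⟩ := P.exists_ball_segment_subset (γ σ)
    obtain ⟨η, hη, hη'⟩ := Metric.continuousWithinAt_iff.1 (hc σ hσ) ε hε
    exact ⟨η, hη, fun τ hτ hd => hb _ (hmem τ hτ) (hη' hτ hd)⟩
  let A : Set ℝ := {σ | σ ∈ Set.Icc (0 : ℝ) 1 ∧ R 0 σ}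
  have h0A : (0 : ℝ) ∈ A := ⟨by simp, hseg le_rfl (by
    rw [segment_same]; exact Set.singleton_subset_iff.2 (hmem 0 (by simp)))⟩
  have hbdd : BddAbove A := ⟨1, fun x hx => hx.1.2⟩
  set m := sSup A with hm
  have hm0 : 0 ≤ m := le_csSup hbdd h0A
  have hm1 : m ≤ 1 := csSup_le ⟨0, h0A⟩ fun x hx => hx.1.2
  obtain ⟨η, hη, hη'⟩ := hloc m ⟨hm0, hm1⟩
  have hRm : R 0 m := by
    obtain ⟨σ, hσA, hσ⟩ := exists_lt_of_lt_csSup ⟨0, h0A⟩ (by linarith : m - η < sSup A)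
    have hσm : σ ≤ m := le_csSup hbdd hσA
    refine htrans hσA.1.1 hσm hσA.2 (hseg hσm ?_)
    rw [segment_symm]
    exact hη' σ hσA.1 (by rw [abs_lt]; constructor <;> linarith)
  have hm_eq : m = 1 := by
    by_contra hne
    have hlt : m < 1 := lt_of_le_of_ne hm1 hne
    have h2 : m < min 1 (m + η / 2) := lt_min hlt (by linarith)
    have h3 : min 1 (m + η / 2) ∈ A := by
      refine ⟨⟨hm0.trans h2.le, min_le_left _ _⟩, htrans hm0 h2.le hRm (hseg h2.le ?_)⟩
      refine hη' _ ⟨hm0.trans h2.le, min_le_left _ _⟩ ?_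
      have := min_le_right 1 (m + η / 2)
      rw [abs_lt]; constructor <;> linarith
    exact absurd (le_csSup hbdd h3) (not_le.2 h2)
  rw [hm_eq] at hRm
  simpa only [R, h0, h1] using hRm

theorem SimplePolygon.exists_shortest {P : SimplePolygon} {s t : Pt} (hs : s ∈ P.region)
    (ht : t ∈ P.region) : ∃ L, Shortest P.region s t L := by
  let A : Set ℝ := {l | ∃ L, PathFrom s t L ∧ polylineSet L ⊆ P.region ∧ polylineLen L = l}
  have hA : A.Nonempty := by
    obtain ⟨L, h1, h2⟩ := exists_pathFrom hs ht
    exact ⟨_, L, h1, h2, rfl⟩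
  have hbdd : BddBelow A := ⟨0, by rintro _ ⟨L, -, -, rfl⟩; exact polylineLen_nonneg L⟩
  set D := sInf A with hD
  have hD0 : 0 ≤ D := le_csInf hA (by rintro _ ⟨L, -, -, rfl⟩; exact polylineLen_nonneg L)
  let F : ℕ → Set (ℝ → Pt) := fun n => (Set.univ.pi fun _ => P.region) ∩
    ({g | g 0 = s} ∩ {g | g 1 = t} ∩
      ⋂ x : ℝ, ⋂ y : ℝ, {g | dist (g x) (g y) ≤ (D + 1 / ((n : ℝ) + 1)) * dist x y})
  have hcl : ∀ n, IsClosed ({g : ℝ → Pt | g 0 = s} ∩ {g | g 1 = t} ∩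
      ⋂ x : ℝ, ⋂ y : ℝ, {g | dist (g x) (g y) ≤ (D + 1 / ((n : ℝ) + 1)) * dist x y}) := by
    intro n
    refine ((isClosed_eq (continuous_apply 0) continuous_const).inter
      (isClosed_eq (continuous_apply 1) continuous_const)).inter ?_
    exact isClosed_iInter fun x => isClosed_iInter fun y =>
      isClosed_le ((continuous_apply x).dist (continuous_apply y)) continuous_const
  have hcpt : ∀ n, IsCompact (F n) := fun n =>
    (isCompact_univ_pi fun _ => P.isCompact_region).inter_right (hcl n)
  obtain ⟨g, hg⟩ := IsCompact.nonempty_iInter_of_sequence_nonempty_isCompact_isClosed F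
    (fun n => by
      rintro g ⟨h1, h2, h3⟩
      refine ⟨h1, h2, ?_⟩
      simp only [Set.mem_iInter] at h3 ⊢
      intro x y
      refine (h3 x y).trans (mul_le_mul_of_nonneg_right ?_ dist_nonneg)
      have : (1 : ℝ) / (((n + 1 : ℕ) : ℝ) + 1) ≤ 1 / ((n : ℝ) + 1) := by
        push_cast
        exact one_div_le_one_div_of_le (by positivity) (by linarith)
      linarith)
    (fun n => by
      have hpos : (0 : ℝ) < 1 / ((n : ℝ) + 1) := by positivity
      obtain ⟨_, ⟨L, h1, h2, rfl⟩, h3⟩ := exists_lt_of_csInf_lt hA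
        (by linarith : sInf A < D + 1 / ((n : ℝ) + 1))
      obtain ⟨g, g0, g1, g2, g3⟩ := h1.exists_lipschitz
      refine ⟨g, fun x _ => h2 (g2 x), ⟨g0, g1⟩, ?_⟩
      simp only [Set.mem_iInter]
      exact fun x y => (g3 x y).trans (mul_le_mul_of_nonneg_right h3.le dist_nonneg))
    (hcpt 0) (fun n => (hcpt n).isClosed)
  rw [Set.mem_iInter] at hg
  have hlip : ∀ x y, dist (g x) (g y) ≤ D * dist x y := by
    intro x y
    have h1 : ∀ n : ℕ, dist (g x) (g y) ≤ (D + 1 / ((n : ℝ) + 1)) * dist x y := fun n => by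
      have := (hg n).2.2
      simp only [Set.mem_iInter] at this
      exact this x y
    have h2 := ((tendsto_one_div_add_atTop_nhds_zero_nat (𝕜 := ℝ)).const_add D).mul_const (dist x y)
    rw [add_zero] at h2
    exact ge_of_tendsto' h2 h1
  have hpath := mem_pathsIn_of_dist_le hD0 hlip (hg 0).2.1.1 (hg 0).2.1.2
    fun x => (hg 0).1 x (Set.mem_univ x)
  obtain ⟨L, h1, h2, h3⟩ := exists_pathFrom_le_eVariationOn hpath
  refine ⟨L, h1, h2, fun M hM hMK => ?_⟩
  have h4 := (ENNReal.ofReal_le_ofReal_iff hD0).1 (h3.trans (eVariationOn_le_of_dist_le hD0 hlip))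
  exact h4.trans (csInf_le hbdd ⟨M, hM, hMK, rfl⟩)

theorem Shortest.ofReal_eq_geodDist {P : SimplePolygon} {s t : Pt} {L : List Pt}
    (h : Shortest P.region s t L) : ENNReal.ofReal (polylineLen L) = P.geodDist s t := by
  refine le_antisymm (le_iInf₂ fun γ hγ => ?_) (SimplePolygon.geodDist_le h.path h.subset)
  obtain ⟨M, h1, h2, h3⟩ := SimplePolygon.exists_pathFrom_le_eVariationOn hγ
  exact (ENNReal.ofReal_le_ofReal (h.le M h1 h2)).trans h3

theorem SimplePolygon.IsGeodesicChain.shortest {P : SimplePolygon} {s t : Pt} {L : List Pt}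
    (h : P.IsGeodesicChain s t L) : Shortest P.region s t L := by
  obtain ⟨h1, h2, -, -, h5, h6⟩ := h
  refine ⟨⟨h1, h2⟩, h5, fun M hM hMK => ?_⟩
  exact (ENNReal.ofReal_le_ofReal_iff (polylineLen_nonneg M)).1
    (h6.trans_le (geodDist_le hM hMK))

theorem polylineSet_append_mono {x : Pt} {T T' : List Pt}
    (h : polylineSet (x :: T') ⊆ polylineSet (x :: T)) :
    ∀ A : List Pt, polylineSet (A ++ x :: T') ⊆ polylineSet (A ++ x :: T)
  | [] => h
  | [_] => Set.union_subset_union_right _ h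
  | _ :: b :: A => Set.union_subset_union_right _ (polylineSet_append_mono h (b :: A))

theorem polylineLen_append_mono {x : Pt} {T T' : List Pt}
    (h : polylineLen (x :: T') ≤ polylineLen (x :: T)) :
    ∀ A : List Pt, polylineLen (A ++ x :: T') ≤ polylineLen (A ++ x :: T)
  | [] => h
  | [_] => add_le_add_right h _
  | _ :: b :: A => add_le_add_right (polylineLen_append_mono h (b :: A)) _

theorem polylineSet_append_cons (x : Pt) (T : List Pt) : ∀ A : List Pt,
    polylineSet (A ++ x :: T) = polylineSet (A ++ [x]) ∪ polylineSet (x :: T)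
  | [] => by
    refine (Set.union_eq_self_of_subset_left ?_).symm
    cases T with
    | nil => exact subset_rfl
    | cons c T => exact Set.singleton_subset_iff.2 (Or.inl (left_mem_segment ℝ x c))
  | [a] => by
    have h := polylineSet_append_cons x T []
    simp only [List.nil_append] at h
    simp only [List.cons_append, List.nil_append, polylineSet]
    rw [Set.union_assoc]
    exact congrArg (segment ℝ a x ∪ ·) h
  | a :: b :: A => by
    have h := polylineSet_append_cons x T (b :: A)
    simp only [List.cons_append, polylineSet] at h ⊢
    rw [h, Set.union_assoc]

theorem polylineLen_append_cons (x : Pt) (T : List Pt) : ∀ A : List Pt,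
    polylineLen (A ++ x :: T) = polylineLen (A ++ [x]) + polylineLen (x :: T)
  | [] => by simp [polylineLen]
  | [a] => by simp [polylineLen]
  | a :: b :: A => by
    have h := polylineLen_append_cons x T (b :: A)
    simp only [List.cons_append, polylineLen] at h ⊢
    rw [h, add_assoc]

theorem PathFrom.initial {s t x : Pt} {A T : List Pt} (h : PathFrom s t (A ++ x :: T)) :
    PathFrom s x (A ++ [x]) := by
  refine ⟨?_, by simp⟩
  have := h.1
  cases A <;> simpa using this

theorem PathFrom.suffix {s t x : Pt} {A T : List Pt} (h : PathFrom s t (A ++ x :: T)) :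
    PathFrom x t (x :: T) := by
  refine ⟨rfl, ?_⟩
  have := h.2
  rwa [List.getLast?_append_of_ne_nil _ (List.cons_ne_nil _ _)] at this

theorem PathFrom.replace {s t x : Pt} {A T T' : List Pt} (h : PathFrom s t (A ++ x :: T))
    (h' : PathFrom x t (x :: T')) : PathFrom s t (A ++ x :: T') := by
  refine ⟨?_, ?_⟩
  · have := h.1
    cases A <;> simpa using this
  · rw [List.getLast?_append_of_ne_nil _ (List.cons_ne_nil _ _)]
    exact h'.2

theorem Shortest.suffix {K : Set Pt} {s t x : Pt} {A T : List Pt}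
    (h : Shortest K s t (A ++ x :: T)) : Shortest K x t (x :: T) := by
  have hK := h.subset
  rw [polylineSet_append_cons] at hK
  refine h.middle h.path.initial h.path.suffix (PathFrom.singleton t)
    (Set.subset_union_left.trans hK) (Set.subset_union_right.trans hK)
    (Set.singleton_subset_iff.2 (h.subset h.path.right_mem)) ?_
  rw [polylineLen_append_cons x T A]
  simp [polylineLen]

theorem Shortest.replace {K : Set Pt} {s t x : Pt} {A T T' : List Pt}
    (h : Shortest K s t (A ++ x :: T)) (h' : PathFrom x t (x :: T'))
    (hset : polylineSet (x :: T') ⊆ polylineSet (x :: T))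
    (hlen : polylineLen (x :: T') ≤ polylineLen (x :: T)) : Shortest K s t (A ++ x :: T') :=
  ⟨h.path.replace h', (polylineSet_append_mono hset A).trans h.subset, fun M hM hMK =>
    (polylineLen_append_mono hlen A).trans (h.le M hM hMK)⟩

namespace SimplePolygon

variable {P : SimplePolygon}

theorem exists_isGeodesicChain {s t : Pt} (hs : s ∈ P.region) (ht : t ∈ P.region) :
    ∃ L, P.IsGeodesicChain s t L := by
  have hex : ∃ n, ∃ L, Shortest P.region s t L ∧ L.length = n :=
    (exists_shortest hs ht).imp' List.length fun L hL => ⟨L, hL, rfl⟩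
  obtain ⟨L, hL, hlen⟩ := Nat.find_spec hex
  have hmin : ∀ M, Shortest P.region s t M → L.length ≤ M.length := fun M hM =>
    hlen ▸ Nat.find_min' hex ⟨M, hM, rfl⟩
  refine ⟨L, hL.path.1, hL.path.2, ?_, fun i hi hdet => ?_, hL.subset, hL.ofReal_eq_geodDist⟩
  · refine List.isChain_iff_forall_rel_of_append_cons_cons.2 ?_
    rintro x x' A B rfl rfl
    have hs := hL.path.suffix
    have := hmin _ (hL.replace (T' := B) ⟨rfl, by simpa using hs.2⟩ Set.subset_union_right
      (by simp [polylineLen]))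
    simp at this
  · obtain ⟨A, B, x, v, w, rfl, rfl⟩ :
        ∃ A B x v w, L = A ++ x :: v :: w :: B ∧ A.length = i := by
      refine ⟨L.take i, L.drop (i + 3), L[i], L[i + 1], L[i + 2], ?_, by simp; omega⟩
      rw [← List.drop_eq_getElem_cons, ← List.drop_eq_getElem_cons, ← List.drop_eq_getElem_cons,
        List.take_append_drop]
    have hdet' : det2 (v - x) (w - x) = 0 := by
      simpa [List.getD_eq_getElem?_getD] using hdet
    have hs := hL.path.suffix
    have := hmin _ (hL.replace (T' := w :: B) ⟨rfl, by simpa using hs.2⟩ ?_ ?_)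
    · simp at this
    · simp only [polylineSet]
      rw [← Set.union_assoc]
      exact Set.union_subset_union_left _ (segment_subset_of_det2_eq_zero hdet')
    · simp only [polylineLen]
      linarith [dist_triangle x v w]

theorem IsGeodesicChain.det2_ne_zero {s t x v w : Pt} {A B : List Pt}
    (h : P.IsGeodesicChain s t (A ++ x :: v :: w :: B)) : det2 (v - x) (w - x) ≠ 0 := by
  have := h.2.2.2.1 A.length (by simp)
  simpa [List.getD_eq_getElem?_getD] using this

theorem IsGeodesicChain.ne {s t x v : Pt} {A B : List Pt}
    (h : P.IsGeodesicChain s t (A ++ x :: v :: B)) : x ≠ v :=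
  List.isChain_iff_forall_rel_of_append_cons_cons.1 h.2.2.1 rfl

theorem det2_eq_zero_of_mem_segment {a b c : Pt} (h : b ∈ segment ℝ a c) :
    det2 (b - a) (c - a) = 0 := by
  rw [segment_eq_image'] at h
  obtain ⟨s, -, rfl⟩ := h
  simp only [det2, PiLp.sub_apply, PiLp.add_apply, PiLp.smul_apply, smul_eq_mul]
  ring

/-- The interior vertices of a geodesic are vertices of the polygon. -/
theorem IsGeodesicChain.mem_vertexSet {s t m v w : Pt} {A B : List Pt}
    (h : P.IsGeodesicChain s t (A ++ m :: v :: w :: B)) : v ∈ P.vertexSet := by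
  by_contra hv
  have hS := h.shortest.suffix
  have hK := hS.subset
  simp only [polylineSet] at hK
  obtain ⟨hmv, hvw, hwB⟩ : segment ℝ m v ⊆ P.region ∧ segment ℝ v w ⊆ P.region ∧
      polylineSet (w :: B) ⊆ P.region := by
    rwa [Set.union_subset_iff, Set.union_subset_iff] at hK
  have hcorner : Shortest P.region m w [m, v, w] := by
    refine hS.middle (PathFrom.singleton m) (((PathFrom.singleton w).cons v).cons m)
      (hS.path.suffix (A := [m, v])) (Set.singleton_subset_iff.2 (hmv (left_mem_segment ℝ m v)))
      ?_ hwB ?_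
    · exact Set.union_subset hmv (Set.union_subset hvw
        (Set.singleton_subset_iff.2 (hvw (right_mem_segment ℝ v w))))
    · simp only [polylineLen]; linarith
  obtain ⟨ε, hε, hconv⟩ := exists_ball_convex hv
  obtain ⟨δ, hδ, hδ1, hδm, hδw⟩ : ∃ δ : ℝ, 0 < δ ∧ δ ≤ 1 ∧ δ * ‖m - v‖ < ε ∧
      δ * ‖w - v‖ < ε := by
    have hs : 0 < ‖m - v‖ + ‖w - v‖ + 1 := by positivity
    have h2 : 0 < min 1 (ε / (‖m - v‖ + ‖w - v‖ + 1)) := by positivity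
    have h1 : min 1 (ε / (‖m - v‖ + ‖w - v‖ + 1)) * (‖m - v‖ + ‖w - v‖ + 1) ≤ ε :=
      (mul_le_mul_of_nonneg_right (min_le_right _ _) hs.le).trans_eq (div_mul_cancel₀ _ hs.ne')
    have h3 := mul_nonneg h2.le (norm_nonneg (m - v))
    have h4 := mul_nonneg h2.le (norm_nonneg (w - v))
    exact ⟨_, h2, min_le_left _ _, by linarith, by linarith⟩
  have hball : ∀ x : Pt, δ * ‖x - v‖ < ε → v + δ • (x - v) ∈ Metric.ball v ε := by
    intro x hx
    rwa [Metric.mem_ball, dist_eq_norm, add_sub_cancel_left, norm_smul, Real.norm_of_nonneg hδ.le]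
  have hseg : ∀ x : Pt, v + δ • (x - v) ∈ segment ℝ v x := fun x => by
    rw [segment_eq_image']
    exact ⟨δ, ⟨hδ.le, hδ1⟩, rfl⟩
  have hmem := mem_segment_of_shortest hcorner hδ hδ1
    (hconv _ (hmv (segment_symm ℝ v m ▸ hseg m)) (hball m hδm) _ (hvw (hseg w)) (hball w hδw))
  exact h.det2_ne_zero (det2_eq_zero_of_mem_segment hmem)

theorem IsGeodesicChain.mem_or {s t x : Pt} {L : List Pt} (h : P.IsGeodesicChain s t L)
    (hx : x ∈ L) : x = s ∨ x = t ∨ x ∈ P.vertexSet := by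
  obtain ⟨A, B, rfl⟩ := List.append_of_mem hx
  rcases A.eq_nil_or_concat with rfl | ⟨A, m, rfl⟩
  · exact Or.inl (by simpa using h.1)
  cases B with
  | nil => exact Or.inr (Or.inl (by simpa using h.2.1))
  | cons w B =>
    rw [List.concat_eq_append, List.append_assoc] at h
    exact Or.inr (Or.inr h.mem_vertexSet)

theorem notMem_vertexSet_of_mem_interior {x : Pt} (hx : x ∈ P.interior) : x ∉ P.vertexSet :=
  fun h => hx.1 (vertexSet_subset_boundary h)

theorem IsGeodesicChain.not_append {p q r c : Pt} {L T : List Pt} (hq : q ∈ P.interior)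
    (hpq : p ≠ q) (hL : P.IsGeodesicChain p q L) : ¬ P.IsGeodesicChain p r (L ++ c :: T) := by
  intro hM
  rcases L.eq_nil_or_concat with rfl | ⟨A, x, rfl⟩
  · simp [IsGeodesicChain] at hL
  rw [List.concat_eq_append] at hL hM
  have hxq : x = q := by simpa using hL.2.1
  subst hxq
  rcases A.eq_nil_or_concat with rfl | ⟨A, m, rfl⟩
  · exact hpq (by simpa using hL.1.symm)
  rw [List.concat_eq_append, List.append_assoc, List.append_assoc] at hM
  exact notMem_vertexSet_of_mem_interior hq hM.mem_vertexSet

theorem _root_.List.exists_diverge {α : Type*} : ∀ {L M : List α}, L ≠ M →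
    (∃ c T, M = L ++ c :: T) ∨ (∃ b T, L = M ++ b :: T) ∨
      ∃ A b c S T, L = A ++ b :: S ∧ M = A ++ c :: T ∧ b ≠ c
  | [], [], h => absurd rfl h
  | [], c :: T, _ => Or.inl ⟨c, T, rfl⟩
  | b :: S, [], _ => Or.inr (Or.inl ⟨b, S, rfl⟩)
  | b :: S, c :: T, h => by
    by_cases hbc : b = c
    · subst hbc
      rcases List.exists_diverge (L := S) (M := T) (fun h' => h (by rw [h'])) with
        ⟨c, T, rfl⟩ | ⟨c, T, rfl⟩ | ⟨A, x, y, S, T, rfl, rfl, hne⟩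
      · exact Or.inl ⟨c, T, rfl⟩
      · exact Or.inr (Or.inl ⟨c, T, rfl⟩)
      · exact Or.inr (Or.inr ⟨b :: A, x, y, S, T, rfl, rfl, hne⟩)
    · exact Or.inr (Or.inr ⟨[], b, c, S, T, rfl, rfl, hbc⟩)

/-- Two distinct geodesics from the same point diverge at a common vertex, with a nonzero
orientation determinant. -/
theorem IsGeodesicChain.exists_diverge {p q r : Pt} {S : Set Pt} {L M : List Pt}
    (hS : NoThreeCollinear S) (hV : P.vertexSet ⊆ S) (hpS : p ∈ S) (hqS : q ∈ S) (hrS : r ∈ S)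
    (hq : q ∈ P.interior) (hr : r ∈ P.interior) (hpq : p ≠ q) (hpr : p ≠ r)
    (hL : P.IsGeodesicChain p q L) (hM : P.IsGeodesicChain p r M) (hLM : L ≠ M) :
    ∃ A a b c T U, L = A ++ a :: b :: T ∧ M = A ++ a :: c :: U ∧ b ≠ c ∧
      det2 (b - a) (c - a) ≠ 0 := by
  rcases List.exists_diverge hLM with ⟨c, T, rfl⟩ | ⟨c, T, rfl⟩ | ⟨A, b, c, T, U, rfl, rfl, hbc⟩
  · exact absurd hM (hL.not_append hq hpq)
  · exact absurd hL (hM.not_append hr hpr)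
  rcases A.eq_nil_or_concat with rfl | ⟨A, a, rfl⟩
  · have h1 := hL.1
    have h2 := hM.1
    simp only [List.nil_append, List.head?_cons, Option.some.injEq] at h1 h2
    exact absurd (h1.trans h2.symm) hbc
  rw [List.concat_eq_append, List.append_assoc] at hL hM
  refine ⟨A, a, b, c, T, U, by simp, by simp, hbc, ?_⟩
  have memL : ∀ x ∈ A ++ ([a] ++ b :: T), x ∈ S := fun x hx => by
    rcases hL.mem_or hx with rfl | rfl | h
    exacts [hpS, hqS, hV h]
  have memM : ∀ x ∈ A ++ ([a] ++ c :: U), x ∈ S := fun x hx => by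
    rcases hM.mem_or hx with rfl | rfl | h
    exacts [hpS, hrS, hV h]
  exact hS a (memL a (by simp)) b (memL b (by simp)) c (memM c (by simp)) hL.ne hM.ne hbc

theorem _root_.Shortest.false_of_diverge {a q b c : Pt} {T U : List Pt}
    (hL : Shortest P.region a q (a :: b :: T)) (hM : Shortest P.region a q (a :: c :: U))
    (hdet : det2 (b - a) (c - a) ≠ 0) : False := by
  have hab : a ≠ b := by
    rintro rfl
    simp [det2] at hdet
  have hac : a ≠ c := by
    rintro rfl
    simp [det2] at hdet
  have tail : ∀ {x : Pt} {V : List Pt}, Shortest P.region a q (a :: x :: V) → a ≠ x →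
      PathFrom x q (x :: V) ∧ a ∉ polylineSet (x :: V) := fun {x V} h hne => by
    have hp := h.path.suffix (A := [a])
    exact ⟨hp, h.notMem_tail hne hp (Set.subset_union_right.trans h.subset) le_rfl⟩
  obtain ⟨hbT, haT⟩ := tail hL hab
  obtain ⟨-, haU⟩ := tail hM hac
  have hcl : IsClosed (polylineSet (b :: T) ∪ polylineSet (c :: U)) :=
    ((isCompact_polylineSet _).union (isCompact_polylineSet _)).isClosed
  obtain ⟨δ, hδ, hball⟩ := Metric.isOpen_iff.1 hcl.isOpen_compl a (by simp [haT, haU])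
  have hmeet : ∀ u ∈ polylineSet (a :: b :: T), u ∈ polylineSet (a :: c :: U) →
      u ∈ Metric.ball a δ → u = a := by
    intro u hu hu' hub
    have hnot := hball hub
    simp only [Set.mem_compl_iff, Set.mem_union, not_or] at hnot
    have h1 := hu.resolve_right hnot.1
    have h2 := hu'.resolve_right hnot.2
    rw [segment_eq_image'] at h1 h2
    obtain ⟨s, -, rfl⟩ := h1
    obtain ⟨t, -, ht⟩ := h2
    have hst : t • (c - a) = s • (b - a) := add_left_cancel ht
    have h0 : s * det2 (b - a) (c - a) = 0 := by
      have e0 := congrArg (fun x : Pt => x 0) hst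
      have e1 := congrArg (fun x : Pt => x 1) hst
      simp only [det2, PiLp.sub_apply, PiLp.smul_apply, smul_eq_mul] at e0 e1 ⊢
      linear_combination (c 0 - a 0) * e1 - (c 1 - a 1) * e0
    rw [(mul_eq_zero.1 h0).resolve_right hdet]
    simp
  have hS : IsClosed (polylineSet (a :: b :: T) \ Metric.ball a δ) :=
    (isCompact_polylineSet _).isClosed.sdiff Metric.isOpen_ball
  have hqS : q ∈ polylineSet (a :: b :: T) \ Metric.ball a δ :=
    ⟨hL.path.right_mem, fun h => hball h (Or.inl hbT.right_mem)⟩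
  obtain ⟨m, y, X, Y, hX, hY, hyS, hXS, hmy, hXM, hmyM, hYM, hlen⟩ :=
    hM.path.exists_first_mem hS (fun h => h.2 (Metric.mem_ball_self hδ))
      ⟨q, hM.path.right_mem, hqS⟩
  have hay : a ≠ y := by
    rintro rfl
    exact hyS.2 (Metric.mem_ball_self hδ)
  have haK : polylineSet [a] ⊆ P.region :=
    Set.singleton_subset_iff.2 (hL.subset hL.path.left_mem)
  obtain ⟨e1, e2, e3⟩ := hX.append (PathFrom.singleton y)
  have hsub : polylineSet (X ++ [y]) ⊆ polylineSet (a :: c :: U) := by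
    rw [e2]
    exact Set.union_subset hXM (Set.union_subset hmyM
      (Set.singleton_subset_iff.2 (hmyM (right_mem_segment ℝ m y))))
  have hM₁ : Shortest P.region a y (X ++ [y]) := by
    refine hM.middle (PathFrom.singleton a) e1 hY haK (hsub.trans hM.subset)
      (hYM.trans hM.subset) ?_
    rw [e3]; simp only [polylineLen] at hlen ⊢; linarith
  obtain ⟨L₁, L₂, l1, l2, l3, l4, l5⟩ := hL.path.exists_split hyS.1
  have hL₁ : Shortest P.region a y L₁ := by
    refine hL.middle (PathFrom.singleton a) l1 l2 haK (l3.trans hL.subset)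
      (l4.trans hL.subset) ?_
    simp only [polylineLen] at l5 ⊢; linarith
  refine false_of_bigon hL₁ hM₁ hay fun u hu => ?_
  by_cases hub : u ∈ Metric.ball a δ
  · exact Or.inl (hmeet u (l3 hu.1) (hsub hu.2) hub)
  · have huS : u ∈ polylineSet (a :: b :: T) \ Metric.ball a δ := ⟨l3 hu.1, hub⟩
    have hu2 := hu.2
    rw [e2] at hu2
    rcases hu2 with h | h | h
    · exact absurd huS (hXS u h)
    · exact Or.inr (hmy u h huS)
    · exact Or.inr h

theorem IsGeodesicChain.unique {p q : Pt} {S : Set Pt} {L M : List Pt}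
    (hS : NoThreeCollinear S) (hV : P.vertexSet ⊆ S) (hpS : p ∈ S) (hqS : q ∈ S)
    (hq : q ∈ P.interior) (hpq : p ≠ q)
    (hL : P.IsGeodesicChain p q L) (hM : P.IsGeodesicChain p q M) : L = M := by
  by_contra hLM
  obtain ⟨A, a, b, c, T, U, rfl, rfl, -, hdet⟩ :=
    hL.exists_diverge hS hV hpS hqS hqS hq hq hpq hpq hM hLM
  exact hL.shortest.suffix.false_of_diverge hM.shortest.suffix hdet

end SimplePolygon

theorem List.eq_of_first_ne {α : Type*} {L M : List α} {i j : ℕ}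
    (hi : ∀ k < i, L[k]? = M[k]?) (hi' : L[i]? ≠ M[i]?)
    (hj : ∀ k < j, L[k]? = M[k]?) (hj' : L[j]? ≠ M[j]?) : i = j :=
  le_antisymm (not_lt.1 fun h => hj' (hi j h)) (not_lt.1 fun h => hi' (hj i h))

namespace SimplePolygon

variable {P : SimplePolygon}

theorem IsGeodesicChain.exists_index {p q r : Pt} {S : Set Pt} {L M : List Pt}
    (hS : NoThreeCollinear S) (hV : P.vertexSet ⊆ S) (hpS : p ∈ S) (hqS : q ∈ S) (hrS : r ∈ S)
    (hq : q ∈ P.interior) (hr : r ∈ P.interior) (hpq : p ≠ q) (hpr : p ≠ r) (hqr : q ≠ r)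
    (hL : P.IsGeodesicChain p q L) (hM : P.IsGeodesicChain p r M) :
    ∃ i : ℕ, 0 < i ∧ (∀ j < i, L[j]? = M[j]?) ∧ L[i]? ≠ M[i]? ∧
      ∃ a b c : Pt, L[i - 1]? = some a ∧ L[i]? = some b ∧ M[i]? = some c ∧
        det2 (b - a) (c - a) ≠ 0 := by
  have hLM : L ≠ M := by
    rintro rfl
    exact hqr (Option.some.inj (hL.2.1.symm.trans hM.2.1))
  obtain ⟨A, a, b, c, T, U, rfl, rfl, hbc, hdet⟩ :=
    hL.exists_diverge hS hV hpS hqS hrS hq hr hpq hpr hM hLM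
  refine ⟨A.length + 1, Nat.succ_pos _, fun j hj => ?_, by simpa using hbc, a, b, c, by simp,
    by simp, by simp, hdet⟩
  rcases (Nat.lt_succ_iff.1 hj).lt_or_eq with h | rfl
  · rw [List.getElem?_append_left h, List.getElem?_append_left h]
  · simp

end SimplePolygon

/-- For three distinct interior points in strong general position (together
with the polygon's vertices), the geodesics from `p` to `q` and from `p` to `r` exist and
have a smallest differing index `i > 0` with a nonzero orientation determinant; hence the
triple `(p,q,r)` is in exactly one of geodesic clockwise or counterclockwise order. -/
theorem geodesic_orientation_well_defined
    (P : SimplePolygon) (p q r : Pt)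
    (hp : p ∈ P.interior) (hq : q ∈ P.interior) (hr : r ∈ P.interior)
    (hpq : p ≠ q) (hpr : p ≠ r) (hqr : q ≠ r)
    (hgp : StrongGenPos (({p, q, r} : Set Pt) ∪ P.vertexSet)) :
    (∃ L, P.IsGeodesicChain p q L) ∧ (∃ M, P.IsGeodesicChain p r M) ∧
    (∀ L M, P.IsGeodesicChain p q L → P.IsGeodesicChain p r M →
      ∃ i : ℕ, 0 < i ∧ (∀ j < i, L[j]? = M[j]?) ∧ L[i]? ≠ M[i]? ∧
        ∃ a b c : Pt, L[i - 1]? = some a ∧ L[i]? = some b ∧ M[i]? = some c ∧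
          det2 (b - a) (c - a) ≠ 0) ∧
    Xor' (geodesicCW P p q r) (geodesicCCW P p q r) := by
  set S : Set Pt := {p, q, r} ∪ P.vertexSet
  have hS : NoThreeCollinear S := hgp.1
  have hV : P.vertexSet ⊆ S := Set.subset_union_right
  have hpS : p ∈ S := Or.inl (by simp)
  have hqS : q ∈ S := Or.inl (by simp)
  have hrS : r ∈ S := Or.inl (by simp)
  have hsub := P.interior_subset_region
  obtain ⟨L, hL⟩ := P.exists_isGeodesicChain (hsub hp) (hsub hq)
  obtain ⟨M, hM⟩ := P.exists_isGeodesicChain (hsub hp) (hsub hr)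
  refine ⟨⟨L, hL⟩, ⟨M, hM⟩, fun L' M' hL' hM' =>
    hL'.exists_index hS hV hpS hqS hrS hq hr hpq hpr hqr hM', ?_⟩
  obtain ⟨i, hi, hlt, hne, a, b, c, ha, hb, hc, hdet⟩ :=
    hL.exists_index hS hV hpS hqS hrS hq hr hpq hpr hqr hM
  have key : ∀ L' M', P.IsGeodesicChain p q L' → P.IsGeodesicChain p r M' → ∀ i' : ℕ,
      (∀ j < i', L'[j]? = M'[j]?) → L'[i']? ≠ M'[i']? → ∀ a' b' c' : Pt,
      L'[i' - 1]? = some a' → L'[i']? = some b' → M'[i']? = some c' →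
      det2 (b' - a') (c' - a') = det2 (b - a) (c - a) := by
    intro L' M' hL' hM' i' hlt' hne' a' b' c' ha' hb' hc'
    obtain rfl := hL.unique hS hV hpS hqS hq hpq hL'
    obtain rfl := hM.unique hS hV hpS hrS hr hpr hM'
    obtain rfl := List.eq_of_first_ne hlt hne hlt' hne'
    rw [Option.some.inj (ha'.symm.trans ha), Option.some.inj (hb'.symm.trans hb),
      Option.some.inj (hc'.symm.trans hc)]
  rcases hdet.lt_or_gt with h | h
  · refine Or.inl ⟨⟨L, M, hL, hM, i, hi, hlt, hne, a, b, c, ha, hb, hc, h⟩, ?_⟩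
    rintro ⟨L', M', hL', hM', i', -, hlt', hne', a', b', c', ha', hb', hc', h'⟩
    exact h.not_gt (key L' M' hL' hM' i' hlt' hne' a' b' c' ha' hb' hc' ▸ h')
  · refine Or.inr ⟨⟨L, M, hL, hM, i, hi, hlt, hne, a, b, c, ha, hb, hc, h⟩, ?_⟩
    rintro ⟨L', M', hL', hM', i', -, hlt', hne', a', b', c', ha', hb', hc', h'⟩
    exact h.not_gt (key L' M' hL' hM' i' hlt' hne' a' b' c' ha' hb' hc' ▸ h')
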